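/- arXiv:2409.18688 — 8 statements merged into one kernel-verified Lean document; each statement's English description precedes it below -/
import Mathlib

section
/- Let N ≥ 1 be an integer, θ ∈ (0,2), p > 1 with p ≠ 1 + θ/N, and T ∈ (0,∞). There exists a constant γ > 0 depending only on N, θ, and p such that: if μ is a nonnegative Radon measure on ℝ^N and there exists a very weak supersolution u of ∂_t u + (−Δ)^{θ/2} u = u^p with initial data μ on ℝ^N × [0,T), then μ(B(z,σ)) ≤ γ σ^{N − θ/(p−1)} for every z ∈ ℝ^N and every σ ∈ (0, T^{1/θ}). -/
open MeasureTheory Real Set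

/-- The fractional Laplacian `(-Δ)^{θ/2}` of `φ : ℝ^N → ℝ` at `x`, defined via the
absolutely convergent second-difference integral with the standard normalizing
constant `A(N,θ)`. -/
noncomputable def fracLap (N : ℕ) (θ : ℝ) (φ : EuclideanSpace ℝ (Fin N) → ℝ)
    (x : EuclideanSpace ℝ (Fin N)) : ℝ :=
  (Real.Gamma ((N + θ) / 2) / (Real.pi ^ ((N : ℝ) / 2) * Real.Gamma (2 - θ / 2))
      * (θ / 2) * (1 - θ / 2)) / 2 *
    ∫ z : EuclideanSpace ℝ (Fin N),
      (2 * φ x - φ (x + z) - φ (x - z)) * ‖z‖ ^ (-(N : ℝ) - θ)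

/-- `u` is a very weak supersolution of `∂_t u + (-Δ)^{θ/2} u = u^p` with initial data `μ`
on `ℝ^N × [0,T)`. -/
def IsVeryWeakSupersolutionFrac (N : ℕ) (θ p T : ℝ)
    (μ : Measure (EuclideanSpace ℝ (Fin N)))
    (u : EuclideanSpace ℝ (Fin N) → ℝ → ℝ) : Prop :=
  Measurable (Function.uncurry u) ∧
  (∀ x : EuclideanSpace ℝ (Fin N), ∀ t ∈ Set.Ioo (0:ℝ) T, 0 ≤ u x t) ∧
  (∀ K : Set (EuclideanSpace ℝ (Fin N)), IsCompact K → ∀ T' ∈ Set.Ioo (0:ℝ) T,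
    IntegrableOn (Function.uncurry u) (K ×ˢ Set.Ioo (0:ℝ) T') ∧
    IntegrableOn (fun q : EuclideanSpace ℝ (Fin N) × ℝ => u q.1 q.2 ^ p)
      (K ×ˢ Set.Ioo (0:ℝ) T')) ∧
  ∀ τ ∈ Set.Ioo (0:ℝ) T, ∀ φ : EuclideanSpace ℝ (Fin N) → ℝ → ℝ,
    ContDiff ℝ (⊤ : ℕ∞) (Function.uncurry φ) →
    HasCompactSupport (Function.uncurry φ) →
    (∀ x t, 0 ≤ φ x t) →
    (∀ x, φ x τ = 0) →
    (∫ t in Set.Ioo (0:ℝ) τ, ∫ x,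
        u x t * (-(deriv (φ x) t) + fracLap N θ (fun y => φ y t) x)) ≥
      (∫ t in Set.Ioo (0:ℝ) τ, ∫ x, u x t ^ p * φ x t) + ∫ x, φ x 0 ∂μ

theorem aux_integral_le {α : Type*} [MeasurableSpace α] {ν : Measure α} {f g : α → ℝ}
    (hg : Integrable g ν) (h0 : ∀ᵐ x ∂ν, 0 ≤ g x) (h : ∀ᵐ x ∂ν, f x ≤ g x) :
    ∫ x, f x ∂ν ≤ ∫ x, g x ∂ν := by
  by_cases hf : Integrable f ν
  · exact integral_mono_ae hf hg h
  · rw [integral_undef hf]; exact integral_nonneg_of_ae h0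

theorem aux_second_diff {E : Type*} [NormedAddCommGroup E] [NormedSpace ℝ E]
    (η : E → ℝ) (hη : ContDiff ℝ (⊤ : ℕ∞) η) (hc : HasCompactSupport η) :
    ∃ C : ℝ, 0 ≤ C ∧ ∀ x z, 2 * η x - η (x + z) - η (x - z) ≤ C * ‖z‖ ^ 2 := by
  have h1 : ContDiff ℝ 1 (fderiv ℝ η) := hη.fderiv_right (by norm_cast)
  obtain ⟨C, hC⟩ := h1.lipschitzWith_of_hasCompactSupport (hc.fderiv (𝕜 := ℝ)) (by norm_num)
  refine ⟨2 * C, by positivity, fun x z => ?_⟩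
  have key : ∀ y ∈ Metric.closedBall x ‖z‖,
      ‖η y - η x - fderiv ℝ η x (y - x)‖ ≤ (C * ‖z‖) * ‖y - x‖ := by
    intro y hy
    refine (convex_closedBall x ‖z‖).norm_image_sub_le_of_norm_hasFDerivWithin_le'
      (f' := fderiv ℝ η) ?_ ?_ (Metric.mem_closedBall_self (norm_nonneg _)) hy
    · intro w _
      exact ((hη.differentiable (by norm_num)) w).hasFDerivAt.hasFDerivWithinAt
    · intro w hw
      have := hC.dist_le_mul w x
      rw [dist_eq_norm] at this
      refine this.trans ?_
      gcongr
      exact hw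
  have a := key (x + z) (by simp)
  have b := key (x - z) (by simp)
  have e1 : x + z - x = z := by abel
  have e2 : x - z - x = -z := by abel
  rw [e1, Real.norm_eq_abs] at a
  rw [e2, Real.norm_eq_abs, norm_neg, map_neg] at b
  have a' := neg_le_of_abs_le a
  have b' := neg_le_of_abs_le b
  nlinarith

theorem aux_integrable (N : ℕ) (hN : 1 ≤ N) (θ : ℝ) (hθ : θ ∈ Set.Ioo (0:ℝ) 2) (L : ℝ) (hL : 0 ≤ L) :
    Integrable (fun z : EuclideanSpace ℝ (Fin N) =>
      min 2 (L * ‖z‖ ^ 2) * ‖z‖ ^ (-(N : ℝ) - θ)) := by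
  have : Nonempty (Fin N) := ⟨⟨0, hN⟩⟩
  have : Nontrivial (EuclideanSpace ℝ (Fin N)) := by
    apply Module.nontrivial_of_finrank_pos (R := ℝ)
    simp; omega
  have := (integrable_fun_norm_addHaar (volume : Measure (EuclideanSpace ℝ (Fin N)))
    (f := fun r : ℝ => min 2 (L * r ^ 2) * r ^ (-(N : ℝ) - θ)))
  refine this.2 ?_
  rw [finrank_euclideanSpace_fin]
  have hpow : ∀ y : ℝ, 0 < y → y ^ (N - 1) * y ^ (-(N : ℝ) - θ) = y ^ (-1 - θ) := by
    intro y hy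
    rw [← Real.rpow_natCast, ← Real.rpow_add hy]
    congr 1
    push_cast [Nat.cast_sub hN]; ring
  have hmeas : Measurable (fun y : ℝ => y ^ (N - 1) • (min 2 (L * y ^ 2) * y ^ (-(N : ℝ) - θ))) := by
    fun_prop
  rw [← Ioc_union_Ioi_eq_Ioi (zero_le_one (α := ℝ))]
  refine IntegrableOn.union ?_ ?_
  · have hi : IntegrableOn (fun y : ℝ => L * y ^ (1 - θ)) (Ioc 0 1) := by
      refine Integrable.const_mul ?_ L
      have := intervalIntegral.intervalIntegrable_rpow' (a := 0) (b := 1) (r := 1 - θ)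
        (by linarith [hθ.2])
      rwa [intervalIntegrable_iff_integrableOn_Ioc_of_le zero_le_one] at this
    refine Integrable.mono' hi hmeas.aestronglyMeasurable ?_
    filter_upwards [ae_restrict_mem measurableSet_Ioc] with y hy
    have hy0 := hy.1
    rw [smul_eq_mul, mul_left_comm, hpow y hy0, Real.norm_eq_abs, abs_of_nonneg (by positivity)]
    calc _ ≤ L * y ^ 2 * y ^ (-1 - θ) := by gcongr; exact min_le_right _ _
      _ = _ := by
        rw [mul_assoc, ← Real.rpow_natCast, ← Real.rpow_add hy0]; congr 2; push_cast; ring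
  · have hi : IntegrableOn (fun y : ℝ => 2 * y ^ (-1 - θ)) (Ioi 1) :=
      (integrableOn_Ioi_rpow_of_lt (by linarith [hθ.1]) one_pos).const_mul 2
    refine Integrable.mono' hi hmeas.aestronglyMeasurable ?_
    filter_upwards [ae_restrict_mem measurableSet_Ioi] with y hy
    have hy0 : 0 < y := one_pos.trans hy
    rw [smul_eq_mul, mul_left_comm, hpow y hy0, Real.norm_eq_abs, abs_of_nonneg (by positivity)]
    gcongr; exact min_le_left _ _

theorem aux_pow (k : ℕ) (a b : ℝ) (ha : 0 ≤ a) (hb : 0 ≤ b) :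
    a ^ k - b ^ k ≤ k * a ^ (k - 1) * (a - b) := by
  induction k with
  | zero => simp
  | succ n ih =>
    rcases Nat.eq_zero_or_pos n with rfl | hn
    · simp
    obtain ⟨m, rfl⟩ : ∃ m, n = m + 1 := ⟨n - 1, by omega⟩
    simp only [Nat.add_sub_cancel] at ih ⊢
    have h2 : 0 ≤ (a ^ (m+1) - b ^ (m+1)) * (a - b) := by
      rcases le_total a b with h | h
      · exact mul_nonneg_of_nonpos_of_nonpos (sub_nonpos.2 (pow_le_pow_left₀ ha h _)) (sub_nonpos.2 h)
      · exact mul_nonneg (sub_nonneg.2 (pow_le_pow_left₀ hb h _)) (sub_nonneg.2 h)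
    have h3 := mul_le_mul_of_nonneg_left ih ha
    push_cast at *
    have e1 : a ^ (m+1+1) = a * a ^ (m+1) := by ring
    have e2 : b ^ (m+1+1) = b * b ^ (m+1) := by ring
    have e3 : a * ((m+1) * a ^ m * (a - b)) = (m+1) * a ^ (m+1) * (a-b) := by ring
    rw [e3] at h3
    rw [e1, e2]
    nlinarith

noncomputable def auxA (N : ℕ) (θ : ℝ) : ℝ :=
  (Real.Gamma ((N + θ) / 2) / (Real.pi ^ ((N : ℝ) / 2) * Real.Gamma (2 - θ / 2))
      * (θ / 2) * (1 - θ / 2)) / 2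

theorem auxA_nonneg (N : ℕ) (θ : ℝ) (hθ : θ ∈ Set.Ioo (0:ℝ) 2) : 0 ≤ auxA N θ := by
  obtain ⟨h1, h2⟩ := hθ
  have g1 : 0 < Real.Gamma ((N + θ) / 2) := Real.Gamma_pos_of_pos (by positivity)
  have g2 : 0 < Real.Gamma (2 - θ / 2) := Real.Gamma_pos_of_pos (by linarith)
  have : 0 ≤ 1 - θ / 2 := by linarith
  unfold auxA
  positivity

theorem aux_fracLap (N : ℕ) (hN : 1 ≤ N) (θ : ℝ) (hθ : θ ∈ Set.Ioo (0:ℝ) 2) (L : ℝ) (hL : 0 ≤ L)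
    (k : ℕ) (σ : ℝ) (hσ : 0 < σ) (w : EuclideanSpace ℝ (Fin N) → ℝ) (h0 : ∀ x, 0 ≤ w x)
    (h1 : ∀ x, w x ≤ 1)
    (h2 : ∀ x z, 2 * w x - w (x + z) - w (x - z) ≤ L * ‖σ⁻¹ • z‖ ^ 2)
    (x : EuclideanSpace ℝ (Fin N)) :
    fracLap N θ (fun y => w y ^ k) x ≤ k * w x ^ (k - 1) * (auxA N θ *
      ∫ z : EuclideanSpace ℝ (Fin N), min 2 (L * ‖z‖ ^ 2) * ‖z‖ ^ (-(N : ℝ) - θ)) / σ ^ θ := by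
  have hA := auxA_nonneg N θ hθ
  have hI := aux_integrable N hN θ hθ L hL
  set g : EuclideanSpace ℝ (Fin N) → ℝ :=
    fun z => min 2 (L * ‖z‖ ^ 2) * ‖z‖ ^ (-(N : ℝ) - θ) with hg
  have hσi : σ⁻¹ ≠ 0 := inv_ne_zero hσ.ne'
  have hI2 : Integrable (fun z => g (σ⁻¹ • z)) := hI.comp_smul hσi
  have hint : ∫ z, g (σ⁻¹ • z) = σ ^ N * ∫ z, g z := by
    rw [Measure.integral_comp_inv_smul_of_nonneg _ _ hσ.le]
    simp
  have hscale : ∀ z, min 2 (L * ‖σ⁻¹ • z‖ ^ 2) * ‖z‖ ^ (-(N : ℝ) - θ)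
      = σ ^ (-(N : ℝ) - θ) * g (σ⁻¹ • z) := by
    intro z
    have : ‖z‖ = σ * ‖σ⁻¹ • z‖ := by
      rw [norm_smul, Real.norm_of_nonneg (by positivity)]; field_simp
    simp only [hg]
    conv_lhs => rw [this]
    rw [Real.mul_rpow hσ.le (norm_nonneg _)]; ring
  have hbound : ∫ z : EuclideanSpace ℝ (Fin N),
      (2 * w x ^ k - w (x + z) ^ k - w (x - z) ^ k) * ‖z‖ ^ (-(N : ℝ) - θ)
      ≤ ∫ z, k * w x ^ (k - 1) * (σ ^ (-(N : ℝ) - θ) * g (σ⁻¹ • z)) := by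
    have hwx := h0 x
    refine aux_integral_le ((hI2.const_mul _).const_mul _) ?_ ?_
    · refine Filter.Eventually.of_forall fun z => ?_
      simp only [hg]
      positivity
    · refine Filter.Eventually.of_forall fun z => ?_
      rw [← hscale z, ← mul_assoc]
      gcongr
      have p1 := aux_pow k (w x) (w (x + z)) (h0 _) (h0 _)
      have p2 := aux_pow k (w x) (w (x - z)) (h0 _) (h0 _)
      calc _ ≤ k * w x ^ (k - 1) * (2 * w x - w (x + z) - w (x - z)) := by linarith
        _ ≤ _ := by
          gcongr
          exact le_min (by linarith [h0 (x+z), h0 (x-z), h1 x]) (h2 x z)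
  rw [integral_const_mul, integral_const_mul, hint] at hbound
  have : fracLap N θ (fun y => w y ^ k) x = auxA N θ * ∫ z : EuclideanSpace ℝ (Fin N),
      (2 * w x ^ k - w (x + z) ^ k - w (x - z) ^ k) * ‖z‖ ^ (-(N : ℝ) - θ) := rfl
  rw [this]
  refine (mul_le_mul_of_nonneg_left hbound hA).trans (le_of_eq ?_)
  rw [Real.rpow_sub hσ, Real.rpow_neg hσ.le, Real.rpow_natCast]
  have : σ ^ N ≠ 0 := by positivity
  have : σ ^ θ ≠ 0 := by positivity
  field_simp

theorem aux_young (p : ℝ) (hp : 1 < p) (k : ℕ) (hk : p / (p - 1) ≤ k) (u w b : ℝ) (hu : 0 ≤ u)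
    (hw : 0 ≤ w) (hw1 : w ≤ 1) (hb : 0 ≤ b) :
    u * (w ^ (k - 1) * b) ≤ u ^ p * w ^ k + b ^ (p / (p - 1)) := by
  have hp0 : 0 < p - 1 := by linarith
  have hk1 : (1:ℝ) < k := lt_of_lt_of_le ((one_lt_div hp0).2 (by linarith)) hk
  have hk1' : 1 < k := by exact_mod_cast hk1
  have hpq : p.HolderConjugate (p / (p - 1)) := Real.HolderConjugate.conjExponent hp
  rcases hw.eq_or_lt with h | hwpos
  · rw [← h, zero_pow (by omega), zero_pow (by omega)]; simp; positivity
  have hle : w ^ (k - 1) ≤ w ^ ((k:ℝ) / p) := by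
    rw [← Real.rpow_natCast]
    apply Real.rpow_le_rpow_of_exponent_ge hwpos hw1
    push_cast [Nat.cast_sub hk1'.le]
    rw [div_le_iff₀ (by linarith)]
    rw [div_le_iff₀ hp0] at hk
    nlinarith
  have hy := Real.young_inequality_of_nonneg (a := u * w ^ ((k:ℝ) / p)) (b := b)
    (by positivity) hb hpq
  have e : (u * w ^ ((k:ℝ) / p)) ^ p = u ^ p * w ^ k := by
    rw [Real.mul_rpow hu (by positivity), ← Real.rpow_mul hw, div_mul_cancel₀ _ (by linarith),
      Real.rpow_natCast]
  rw [e] at hy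
  have d1 : u ^ p * w ^ k / p ≤ u ^ p * w ^ k := div_le_self (by positivity) hp.le
  have d2 : b ^ (p / (p-1)) / (p / (p-1)) ≤ b ^ (p / (p-1)) :=
    div_le_self (by positivity) (by rw [le_div_iff₀ hp0]; linarith)
  calc _ ≤ u * (w ^ ((k:ℝ) / p) * b) := by gcongr
    _ = u * w ^ ((k:ℝ) / p) * b := by ring
    _ ≤ _ := by linarith

set_option maxHeartbeats 1000000 in
/-- Necessary condition on the initial data for the existence of a very weak supersolution
of the fractional semilinear heat equation, in the non-critical case `p ≠ 1 + θ/N`. -/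
theorem stmt_0 (N : ℕ) (hN : 1 ≤ N) (θ : ℝ) (hθ : θ ∈ Set.Ioo (0:ℝ) 2)
    (p : ℝ) (hp : 1 < p) (hpF : p ≠ 1 + θ / N) :
    ∃ γ : ℝ, 0 < γ ∧ ∀ T : ℝ, 0 < T →
      ∀ μ : Measure (EuclideanSpace ℝ (Fin N)), IsFiniteMeasureOnCompacts μ →
      (∃ u, IsVeryWeakSupersolutionFrac N θ p T μ u) →
      ∀ z : EuclideanSpace ℝ (Fin N), ∀ σ : ℝ, 0 < σ → σ < T ^ (1/θ) →
        μ (Metric.ball z σ) ≤ ENNReal.ofReal (γ * σ ^ ((N:ℝ) - θ / (p - 1))) := by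
  
  classical
  have hp0 : 0 < p - 1 := by linarith
  obtain ⟨k, hk⟩ := exists_nat_ge (p / (p - 1))
  have hk1 : (1:ℝ) < k := lt_of_lt_of_le ((one_lt_div hp0).2 (by linarith)) hk
  have hk1' : 1 < k := by exact_mod_cast hk1
  let η : ContDiffBump (0 : EuclideanSpace ℝ (Fin N)) := ⟨1, 2, one_pos, one_lt_two⟩
  let ζ : ContDiffBump (0 : ℝ) := ⟨1/2, 1, by norm_num, by norm_num⟩
  obtain ⟨L, hL, hLη⟩ := aux_second_diff η η.contDiff η.hasCompactSupport
  obtain ⟨M, hM⟩ : ∃ M, ∀ t, ‖deriv ζ t‖ ≤ M := by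
    have hc : Continuous (deriv ζ) := (ζ.contDiff (n := 1)).continuous_deriv (by norm_num)
    exact hc.bounded_above_of_compact_support ζ.hasCompactSupport.deriv
  have hM0 : 0 ≤ M := (norm_nonneg _).trans (hM 0)
  set I : ℝ := auxA N θ * ∫ z : EuclideanSpace ℝ (Fin N),
    min 2 (L * ‖z‖ ^ 2) * ‖z‖ ^ (-(N : ℝ) - θ) with hIdef
  have hI0 : 0 ≤ I := mul_nonneg (auxA_nonneg N θ hθ)
    (integral_nonneg fun z => by positivity)
  set q : ℝ := p / (p - 1) with hq
  set V : ℝ := (volume : Measure (EuclideanSpace ℝ (Fin N))).real (Metric.closedBall 0 1) with hV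
  set K : ℝ := k * (M + I) with hKdef
  have hK0 : 0 ≤ K := by positivity
  refine ⟨K ^ q * (2 ^ N * V) + 1, by positivity, ?_⟩
  rintro T hT μ hμ ⟨u, hum, hu0, huint, hu⟩ z σ hσ hσT
  set τ : ℝ := σ ^ θ with hτ
  have hτ0 : 0 < τ := by positivity
  have hτT : τ < T := by
    have := Real.rpow_lt_rpow hσ.le hσT hθ.1
    rwa [← Real.rpow_mul hT.le, one_div_mul_cancel hθ.1.ne', Real.rpow_one] at this
  let w : EuclideanSpace ℝ (Fin N) → ℝ → ℝ := fun x t => η (σ⁻¹ • (x - z)) * ζ (τ⁻¹ * t)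
  have hw0 : ∀ x t, 0 ≤ w x t := fun x t => mul_nonneg η.nonneg ζ.nonneg
  have hw1 : ∀ x t, w x t ≤ 1 := fun x t => mul_le_one₀ η.le_one ζ.nonneg ζ.le_one
  set B : Set (EuclideanSpace ℝ (Fin N)) := Metric.closedBall z (2 * σ) with hB
  have hwB : ∀ x t, x ∉ B → w x t = 0 := by
    intro x t hx
    have : η (σ⁻¹ • (x - z)) = 0 := by
      apply η.zero_of_le_dist
      have h3 : 2 * σ < ‖x - z‖ := by simpa [hB, dist_eq_norm] using hx
      change (2:ℝ) ≤ _
      rw [dist_zero_right, norm_smul, Real.norm_of_nonneg (by positivity), le_inv_mul_iff₀ hσ]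
      linarith
    simp [w, this]
  have hwt : ∀ x t, t ∉ Set.Icc (-τ) τ → w x t = 0 := by
    intro x t ht
    have : ζ (τ⁻¹ * t) = 0 := by
      apply ζ.zero_of_le_dist
      change (1:ℝ) ≤ _
      rw [dist_zero_right, norm_mul, Real.norm_of_nonneg (by positivity), le_inv_mul_iff₀ hτ0]
      by_contra hh
      push Not at hh
      rw [mul_one, Real.norm_eq_abs, abs_lt] at hh
      exact ht ⟨hh.1.le, hh.2.le⟩
    simp [w, this]
  have hwτ : ∀ x, w x τ = 0 := by
    intro x
    have : ζ (τ⁻¹ * τ) = 0 := by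
      apply ζ.zero_of_le_dist
      change (1:ℝ) ≤ _
      rw [inv_mul_cancel₀ hτ0.ne']; simp
    simp [w, this]
  have hwone : ∀ x ∈ Metric.ball z σ, w x 0 = 1 := by
    intro x hx
    have a : η (σ⁻¹ • (x - z)) = 1 := by
      apply η.one_of_mem_closedBall
      rw [mem_closedBall_zero_iff, norm_smul, Real.norm_of_nonneg (by positivity)]
      change _ ≤ (1:ℝ)
      rw [inv_mul_le_iff₀ hσ]
      rw [Metric.mem_ball, dist_eq_norm] at hx
      linarith
    have b : ζ (τ⁻¹ * 0) = 1 := by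
      apply ζ.one_of_mem_closedBall
      simpa using ζ.rIn_pos.le
    simp only [w, a, b, mul_one]
  have hwsm : ContDiff ℝ (⊤ : ℕ∞) (Function.uncurry w) := by
    have a : ContDiff ℝ (⊤ : ℕ∞) (fun q : EuclideanSpace ℝ (Fin N) × ℝ => η (σ⁻¹ • (q.1 - z))) :=
      η.contDiff.comp ((contDiff_fst.sub contDiff_const).const_smul _)
    have b : ContDiff ℝ (⊤ : ℕ∞) (fun q : EuclideanSpace ℝ (Fin N) × ℝ => ζ (τ⁻¹ * q.2)) :=
      ζ.contDiff.comp (contDiff_const.mul contDiff_snd)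
    exact a.mul b
  let φ : EuclideanSpace ℝ (Fin N) → ℝ → ℝ := fun x t => w x t ^ k
  have hφsm : ContDiff ℝ (⊤ : ℕ∞) (Function.uncurry φ) := hwsm.pow k
  have hBc : IsCompact B := isCompact_closedBall _ _
  have hφc : HasCompactSupport (Function.uncurry φ) := by
    refine HasCompactSupport.intro (hBc.prod (isCompact_Icc (a := -τ) (b := τ))) ?_
    rintro ⟨x, t⟩ hxt
    have : w x t = 0 := by
      by_cases hx : x ∈ B
      · exact hwt x t fun ht => hxt ⟨hx, ht⟩
      · exact hwB x t hx
    simp only [Function.uncurry, φ, this]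
    exact zero_pow (by omega)
  have hφ0 : ∀ x t, 0 ≤ φ x t := fun x t => pow_nonneg (hw0 x t) k
  have hφ1 : ∀ x t, φ x t ≤ 1 := fun x t => pow_le_one₀ (hw0 x t) (hw1 x t)
  have main := hu τ ⟨hτ0, hτT⟩ φ hφsm hφc hφ0
    (fun x => by simp only [φ, hwτ x]; exact zero_pow (by omega))
  set c : ℝ := (K / τ) ^ q with hc
  have hc0 : 0 ≤ c := by positivity
  -- pointwise bound
  have hpt : ∀ x, ∀ t ∈ Set.Ioo (0:ℝ) τ,
      u x t * (-(deriv (φ x) t) + fracLap N θ (fun y => φ y t) x)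
        ≤ u x t ^ p * φ x t + B.indicator (fun _ => c) x := by
    intro x t ht
    have hux := hu0 x t ⟨ht.1, ht.2.trans hτT⟩
    have hd : -(deriv (φ x) t) ≤ k * w x t ^ (k - 1) * M / τ := by
      have h1 : HasDerivAt (w x) (η (σ⁻¹ • (x - z)) * (deriv ζ (τ⁻¹ * t) * τ⁻¹)) t := by
        have hz : HasDerivAt ζ (deriv ζ (τ⁻¹ * t)) (τ⁻¹ * t) :=
          ((ζ.contDiff (n := 1)).differentiable (by norm_num) _).hasDerivAt
        have hl : HasDerivAt (fun s : ℝ => τ⁻¹ * s) τ⁻¹ t := by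
          simpa using (hasDerivAt_id t).const_mul τ⁻¹
        exact (hz.comp t hl).const_mul _
      have h2 : HasDerivAt (φ x) _ t := h1.pow k
      rw [h2.deriv]
      have h3 := hM (τ⁻¹ * t)
      rw [Real.norm_eq_abs] at h3
      have h4 := neg_le_of_abs_le h3
      have hww := hw0 x t
      have e1 : (0:ℝ) ≤ η (σ⁻¹ • (x - z)) := η.nonneg
      have e2 : η (σ⁻¹ • (x - z)) ≤ 1 := η.le_one
      have h5 : η (σ⁻¹ • (x - z)) * (-deriv ζ (τ⁻¹ * t)) ≤ M := by
        calc _ ≤ η (σ⁻¹ • (x - z)) * M := by gcongr; linarith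
          _ ≤ 1 * M := by gcongr
          _ = M := one_mul _
      calc _ = k * w x t ^ (k - 1) * (η (σ⁻¹ • (x - z)) * (-deriv ζ (τ⁻¹ * t))) / τ := by
            rw [div_eq_mul_inv]; ring
        _ ≤ _ := by gcongr
    have hf : fracLap N θ (fun y => φ y t) x ≤ k * w x t ^ (k - 1) * I / τ := by
      refine aux_fracLap N hN θ hθ L hL k σ hσ (fun y => w y t) (fun y => hw0 y t)
        (fun y => hw1 y t) ?_ x
      intro y v
      have h1 := hLη (σ⁻¹ • (y - z)) (σ⁻¹ • v)
      have e1 : σ⁻¹ • (y - z) + σ⁻¹ • v = σ⁻¹ • (y + v - z) := by rw [← smul_add]; congr 1; abel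
      have e2 : σ⁻¹ • (y - z) - σ⁻¹ • v = σ⁻¹ • (y - v - z) := by rw [← smul_sub]; congr 1; abel
      rw [e1, e2] at h1
      have z0 : (0:ℝ) ≤ ζ (τ⁻¹ * t) := ζ.nonneg
      have z1 : ζ (τ⁻¹ * t) ≤ 1 := ζ.le_one
      calc _ = (2 * η (σ⁻¹ • (y - z)) - η (σ⁻¹ • (y + v - z)) - η (σ⁻¹ • (y - v - z)))
            * ζ (τ⁻¹ * t) := by simp only [w]; ring
        _ ≤ (L * ‖σ⁻¹ • v‖ ^ 2) * ζ (τ⁻¹ * t) := by gcongr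
        _ ≤ _ := mul_le_of_le_one_right (by positivity) z1
    have hsum : u x t * (-(deriv (φ x) t) + fracLap N θ (fun y => φ y t) x)
        ≤ u x t * (w x t ^ (k - 1) * (K / τ)) := by
      refine mul_le_mul_of_nonneg_left ((add_le_add hd hf).trans (le_of_eq ?_)) hux
      rw [hKdef]; ring
    refine hsum.trans ?_
    by_cases hx : x ∈ B
    · rw [indicator_of_mem hx]
      exact aux_young p hp k hk _ _ _ hux (hw0 x t) (hw1 x t) (by positivity)
    · rw [indicator_of_notMem hx, hwB x t hx, zero_pow (by omega)]
      have := mul_nonneg (Real.rpow_nonneg hux p) (hφ0 x t)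
      linarith
  -- integrability
  set ν : Measure ℝ := volume.restrict (Set.Ioo (0:ℝ) τ) with hν
  have hG1 : Integrable (fun r : EuclideanSpace ℝ (Fin N) × ℝ => u r.1 r.2 ^ p * φ r.1 r.2)
      ((volume : Measure (EuclideanSpace ℝ (Fin N))).prod ν) := by
    have h1 := (huint B hBc τ ⟨hτ0, hτT⟩).2
    rw [IntegrableOn, Measure.volume_eq_prod, ← Measure.prod_restrict] at h1
    have h2 : Integrable (fun r : EuclideanSpace ℝ (Fin N) × ℝ => u r.1 r.2 ^ p * φ r.1 r.2)
        ((volume.restrict B).prod ν) := by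
      refine h1.mul_bdd (c := 1) hφsm.continuous.aestronglyMeasurable ?_
      refine Filter.Eventually.of_forall fun r => ?_
      rw [Real.norm_of_nonneg (hφ0 _ _)]; exact hφ1 _ _
    have e : (volume.restrict B).prod ν = ((volume : Measure (EuclideanSpace ℝ (Fin N))).prod ν).restrict
        (B ×ˢ Set.univ) := by rw [← Measure.prod_restrict, Measure.restrict_univ]
    rw [e] at h2
    refine (integrableOn_iff_integrable_of_support_subset ?_).1 h2
    rintro ⟨x, t⟩ hxt
    refine ⟨?_, mem_univ _⟩
    by_contra hx
    apply hxt
    simp only [φ]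
    rw [hwB x t hx, zero_pow (by omega), mul_zero]
  have hBi : Integrable (B.indicator (fun _ => c)) (volume : Measure (EuclideanSpace ℝ (Fin N))) :=
    (integrable_indicator_iff measurableSet_closedBall).2
      (integrableOn_const hBc.measure_lt_top.ne)
  have hJ1 : Integrable (fun t => ∫ x, u x t ^ p * φ x t) ν := hG1.integral_prod_right
  have hJ2 : ∀ᵐ t ∂ν, Integrable (fun x => u x t ^ p * φ x t) := hG1.prod_left_ae
  set W : ℝ := (volume : Measure (EuclideanSpace ℝ (Fin N))).real B with hW
  have hWc : ∫ x, B.indicator (fun _ => c) x = W * c := by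
    rw [integral_indicator measurableSet_closedBall, setIntegral_const, smul_eq_mul]
  have hmem : ∀ᵐ t ∂ν, t ∈ Set.Ioo (0:ℝ) τ := ae_restrict_mem measurableSet_Ioo
  have hcst : Integrable (fun _ : ℝ => W * c) ν := integrable_const _
  have hub : (∫ t in Set.Ioo (0:ℝ) τ, ∫ x,
      u x t * (-(deriv (φ x) t) + fracLap N θ (fun y => φ y t) x)) ≤
      ∫ t in Set.Ioo (0:ℝ) τ, ((∫ x, u x t ^ p * φ x t) + W * c) := by
    have hnn : ∀ t ∈ Set.Ioo (0:ℝ) τ, ∀ x, 0 ≤ u x t ^ p * φ x t := fun t ht x =>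
      mul_nonneg (Real.rpow_nonneg (hu0 x t ⟨ht.1, ht.2.trans hτT⟩) p) (hφ0 x t)
    refine aux_integral_le (hJ1.add hcst) ?_ ?_
    · filter_upwards [hmem] with t ht
      exact add_nonneg (integral_nonneg (hnn t ht)) (by positivity)
    · filter_upwards [hmem, hJ2] with t ht hi
      rw [← hWc, ← integral_add hi hBi]
      refine aux_integral_le (hi.add hBi) ?_ ?_
      · exact Filter.Eventually.of_forall fun x =>
          add_nonneg (hnn t ht x) (indicator_nonneg (fun _ _ => hc0) x)
      · exact Filter.Eventually.of_forall fun x => hpt x t ht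
  rw [integral_add hJ1 hcst, setIntegral_const, smul_eq_mul] at hub
  have hfin : ∫ x, φ x 0 ∂μ ≤ τ * (W * c) := by
    have : volume.real (Set.Ioo (0:ℝ) τ) = τ := by simp [Measure.real, hτ0.le]
    rw [this] at hub
    linarith
  -- lower bound
  have hφc0 : Integrable (fun x => φ x 0) μ := by
    have hcont : Continuous (fun x => φ x 0) :=
      Continuous.comp (g := Function.uncurry φ)
        (f := fun x : EuclideanSpace ℝ (Fin N) => (x, (0:ℝ))) hφsm.continuous (by fun_prop)
    refine hcont.integrable_of_hasCompactSupport (HasCompactSupport.intro hBc fun x hx => ?_)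
    simp only [φ]
    rw [hwB x 0 hx, zero_pow (by omega)]
  have hlow : μ (Metric.ball z σ) ≤ ENNReal.ofReal (∫ x, φ x 0 ∂μ) := by
    rw [ofReal_integral_eq_lintegral_ofReal hφc0 (Filter.Eventually.of_forall fun x => hφ0 x 0)]
    calc μ (Metric.ball z σ) = ∫⁻ x in Metric.ball z σ, 1 ∂μ := by simp
      _ ≤ ∫⁻ x in Metric.ball z σ, ENNReal.ofReal (φ x 0) ∂μ := by
        refine setLIntegral_mono' Metric.isOpen_ball.measurableSet fun x hx => ?_
        simp only [φ]
        rw [hwone x hx]; simp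
      _ ≤ _ := setLIntegral_le_lintegral _ _
  refine hlow.trans (ENNReal.ofReal_le_ofReal (hfin.trans ?_))
  have hWV : W = (2 * σ) ^ N * V := by
    rw [hW, hV, hB, Measure.addHaar_real_closedBall _ _ (by positivity),
      Measure.addHaar_real_closedBall _ _ zero_le_one]
    simp
  have hcc : τ * c = K ^ q * σ ^ (- (θ / (p - 1))) := by
    rw [hc, Real.div_rpow hK0 hτ0.le]
    have : σ ^ (-(θ / (p-1))) = τ / τ ^ q := by
      rw [hτ, ← Real.rpow_mul hσ.le, ← Real.rpow_sub hσ]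
      congr 1
      rw [hq]; field_simp; ring
    rw [this]; ring
  have hs : σ ^ ((N:ℝ) - θ / (p - 1)) = σ ^ N * σ ^ (-(θ / (p - 1))) := by
    rw [sub_eq_add_neg, Real.rpow_add hσ, Real.rpow_natCast]
  calc τ * (W * c) = W * (τ * c) := by ring
    _ = K ^ q * (2 ^ N * V) * σ ^ ((N:ℝ) - θ / (p - 1)) := by
      rw [hcc, hWV, hs, mul_pow]; ring
    _ ≤ _ := by gcongr; linarith
end

section
/- Let N ≥ 1 be an integer, p > 1 with p ≠ 1 + 2/N, and T ∈ (0,∞). There exists a constant γ > 0 depending only on N and p such that: if μ is a nonnegative Radon measure on ℝ^N and there exists a very weak supersolution u of ∂_t u − Δu = u^p with initial data μ on ℝ^N × [0,T), then μ(B(z,σ)) ≤ γ σ^{N − 2/(p−1)} for every z ∈ ℝ^N and every σ ∈ (0, T^{1/2}). -/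
open MeasureTheory Real Set

/-- The Euclidean Laplacian `Δφ(x) = Σ_i ∂²φ/∂x_i²(x)` of `φ : ℝ^N → ℝ`. -/
noncomputable def euclLap (N : ℕ) (φ : EuclideanSpace ℝ (Fin N) → ℝ)
    (x : EuclideanSpace ℝ (Fin N)) : ℝ :=
  ∑ i : Fin N,
    iteratedFDeriv ℝ 2 φ x ![EuclideanSpace.single i 1, EuclideanSpace.single i 1]

/-- `u` is a very weak supersolution of `∂_t u - Δ u = u^p` with initial data `μ`
on `ℝ^N × [0,T)`. -/
def IsVeryWeakSupersolutionHeat (N : ℕ) (p T : ℝ)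
    (μ : Measure (EuclideanSpace ℝ (Fin N)))
    (u : EuclideanSpace ℝ (Fin N) → ℝ → ℝ) : Prop :=
  Measurable (Function.uncurry u) ∧
  (∀ x : EuclideanSpace ℝ (Fin N), ∀ t ∈ Set.Ioo (0:ℝ) T, 0 ≤ u x t) ∧
  (∀ K : Set (EuclideanSpace ℝ (Fin N)), IsCompact K → ∀ T' ∈ Set.Ioo (0:ℝ) T,
    IntegrableOn (Function.uncurry u) (K ×ˢ Set.Ioo (0:ℝ) T') ∧
    IntegrableOn (fun q : EuclideanSpace ℝ (Fin N) × ℝ => u q.1 q.2 ^ p)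
      (K ×ˢ Set.Ioo (0:ℝ) T')) ∧
  ∀ τ ∈ Set.Ioo (0:ℝ) T, ∀ φ : EuclideanSpace ℝ (Fin N) → ℝ → ℝ,
    ContDiff ℝ (⊤ : ℕ∞) (Function.uncurry φ) →
    HasCompactSupport (Function.uncurry φ) →
    (∀ x t, 0 ≤ φ x t) →
    (∀ x, φ x τ = 0) →
    (∫ t in Set.Ioo (0:ℝ) τ, ∫ x,
        u x t * (-(deriv (φ x) t) - euclLap N (fun y => φ y t) x)) ≥
      (∫ t in Set.Ioo (0:ℝ) τ, ∫ x, u x t ^ p * φ x t) + ∫ x, φ x 0 ∂μ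


lemma aux_d2 {E : Type*} [NormedAddCommGroup E] [NormedSpace ℝ E] (f : E → ℝ) (hf : ContDiff ℝ (⊤ : ℕ∞) f)
    (x e : E) : iteratedFDeriv ℝ 2 f x ![e, e] = fderiv ℝ (fun y => fderiv ℝ f y e) x e := by
  rw [iteratedFDeriv_two_apply]
  have h : DifferentiableAt ℝ (fderiv ℝ f) x :=
    ((hf.fderiv_right (m := 1) (by norm_cast)).differentiable (by simp)) x
  rw [fderiv_clm_apply h (differentiableAt_const e)]
  simp

lemma aux_scale {N : ℕ} (f : EuclideanSpace ℝ (Fin N) → ℝ) (hf : ContDiff ℝ (⊤ : ℕ∞) f)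
    (z x : EuclideanSpace ℝ (Fin N)) (c : ℝ) :
    euclLap N (fun y => f (c • (y - z))) x = c ^ 2 * euclLap N f (c • (x - z)) := by
  unfold euclLap
  rw [Finset.mul_sum]
  refine Finset.sum_congr rfl fun i _ => ?_
  have hg : ContDiff ℝ (⊤ : ℕ∞) (fun y => f (c • (y - z))) := by fun_prop
  rw [aux_d2 _ hg, aux_d2 _ hf]
  set e := EuclideanSpace.single i (1:ℝ)
  have hD : Differentiable ℝ (fun y => fderiv ℝ f y e) :=
    ((hf.fderiv_right (m := 1) (by norm_cast)).clm_apply contDiff_const).differentiable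
      (by simp)
  have key : ∀ (h : EuclideanSpace ℝ (Fin N) → ℝ), Differentiable ℝ h → ∀ y,
      fderiv ℝ (fun y => h (c • (y - z))) y e = c * fderiv ℝ h (c • (y - z)) e := by
    intro h hh y
    have h1 : HasFDerivAt (fun y : EuclideanSpace ℝ (Fin N) => c • (y - z))
        (c • ContinuousLinearMap.id ℝ _) y := ((hasFDerivAt_id y).sub_const z).const_smul c
    have h2 := (hh (c • (y - z))).hasFDerivAt.comp y h1
    have h3 := h2.fderiv
    simp only [Function.comp_def] at h3
    rw [h3]; simp
  have e1 : (fun y => fderiv ℝ (fun y => f (c • (y - z))) y e)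
      = fun y => c * (fun w => fderiv ℝ f w e) (c • (y - z)) := by
    funext y; exact key f (hf.differentiable (by simp)) y
  rw [e1, fderiv_const_mul (by fun_prop)]
  simp only [smul_apply, smul_eq_mul]
  rw [key _ hD]; ring

lemma aux_bdd {E : Type*} [NormedAddCommGroup E] [NormedSpace ℝ E] (f : E → ℝ)
    (hf : ContDiff ℝ (⊤ : ℕ∞) f) (hc : HasCompactSupport f) (e : E) :
    ∃ C, 0 ≤ C ∧ ∀ x, |fderiv ℝ f x e| ≤ C := by
  have h1 : Continuous (fun x => fderiv ℝ f x e) :=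
    (hf.continuous_fderiv (by simp)).clm_apply continuous_const
  have h2 : HasCompactSupport (fun x => fderiv ℝ f x e) :=
    hc.fderiv_apply (𝕜 := ℝ) e
  obtain ⟨C, hC⟩ := h2.exists_bound_of_continuous h1
  exact ⟨C, (norm_nonneg _).trans (hC 0), hC⟩

lemma aux_pow_d {E : Type*} [NormedAddCommGroup E] [NormedSpace ℝ E] (a : E → ℝ)
    (ha : ContDiff ℝ (⊤ : ℕ∞) a) (hc : HasCompactSupport a) (h0 : ∀ x, 0 ≤ a x) 
    (e : E) (k : ℕ) : ∃ C, 0 ≤ C ∧ ∀ x, |fderiv ℝ (fun y => a y ^ (k+1)) x e| ≤ C * a x ^ k := by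
  obtain ⟨C, hC, h⟩ := aux_bdd a ha hc e
  refine ⟨(k+1) * C, by positivity, fun x => ?_⟩
  have hd : DifferentiableAt ℝ a x := ha.differentiable (by simp) x
  rw [fderiv_fun_pow _ hd]
  simp only [smul_apply, smul_eq_mul, nsmul_eq_mul, abs_mul, abs_pow,
    abs_of_nonneg (h0 x), Nat.add_sub_cancel, Nat.cast_add, Nat.cast_one]
  rw [abs_of_nonneg (by positivity : (0:ℝ) ≤ k + 1)]
  have := h x
  have := pow_nonneg (h0 x) k
  calc _ ≤ (k+1) * a x ^ k * C := by gcongr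
    _ = _ := by ring

lemma aux_pow_d2 {E : Type*} [NormedAddCommGroup E] [NormedSpace ℝ E] (a : E → ℝ)
    (ha : ContDiff ℝ (⊤ : ℕ∞) a) (hc : HasCompactSupport a) (h0 : ∀ x, 0 ≤ a x)
    (h1 : ∀ x, a x ≤ 1)
    (e : E) (k : ℕ) : ∃ C, 0 ≤ C ∧ ∀ x,
      |iteratedFDeriv ℝ 2 (fun y => a y ^ (k+2)) x ![e, e]| ≤ C * a x ^ k := by
  have hD : ContDiff ℝ (⊤ : ℕ∞) (fun y => fderiv ℝ a y e) :=
    (ha.fderiv_right (by simp)).clm_apply contDiff_const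
  have h2 : HasCompactSupport (fun x => fderiv ℝ a x e) := hc.fderiv_apply (𝕜 := ℝ) e
  obtain ⟨C, hC, h⟩ := aux_bdd a ha hc e
  obtain ⟨C1, hC1, h1'⟩ := aux_pow_d a ha hc h0 e k
  obtain ⟨C2, hC2, h2'⟩ := aux_bdd _ hD h2 e
  refine ⟨(k+2) * (C1 * C + C2), by positivity, fun x => ?_⟩
  rw [aux_d2 _ (by fun_prop)]
  have e1 : (fun y => fderiv ℝ (fun y => a y ^ (k+2)) y e)
      = fun y => ((k:ℝ)+2) * ((a y ^ (k+1)) * fderiv ℝ a y e) := by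
    funext y
    rw [fderiv_fun_pow _ (ha.differentiable (by simp) y)]
    simp [mul_assoc]
  have hd1 : DifferentiableAt ℝ (fun y => a y ^ (k+1)) x :=
    (ha.pow (k+1)).differentiable (by simp) x
  have hd2 : DifferentiableAt ℝ (fun y => fderiv ℝ a y e) x := hD.differentiable (by simp) x
  rw [e1, fderiv_const_mul (hd1.fun_mul hd2), fderiv_fun_mul hd1 hd2]
  simp only [smul_apply, add_apply, smul_eq_mul]
  rw [abs_mul, abs_of_nonneg (by positivity : (0:ℝ) ≤ k + 2), mul_assoc]
  gcongr
  have hk := pow_nonneg (h0 x) k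
  have hk1 : a x ^ (k+1) ≤ a x ^ k := pow_le_pow_of_le_one (h0 x) (h1 x) (by simp)
  calc _ ≤ |a x ^ (k+1)| * |fderiv ℝ (fun y => fderiv ℝ a y e) x e| +
        |fderiv ℝ a x e| * |fderiv ℝ (fun y => a y ^ (k+1)) x e| := by
          rw [← abs_mul, ← abs_mul]; exact abs_add_le _ _
    _ ≤ a x ^ k * C2 + C * (C1 * a x ^ k) := by
          rw [abs_of_nonneg (pow_nonneg (h0 x) (k+1))]
          gcongr
          · exact h2' x
          · exact h x
          · exact h1' x
    _ = _ := by ring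

lemma aux_lap {N : ℕ} (a : EuclideanSpace ℝ (Fin N) → ℝ)
    (ha : ContDiff ℝ (⊤ : ℕ∞) a) (hc : HasCompactSupport a) (h0 : ∀ x, 0 ≤ a x)
    (h1 : ∀ x, a x ≤ 1) (k : ℕ) : ∃ C, 0 ≤ C ∧ ∀ x,
      |euclLap N (fun y => a y ^ (k+2)) x| ≤ C * a x ^ k := by
  choose C hC h using fun i : Fin N => aux_pow_d2 a ha hc h0 h1 (EuclideanSpace.single i (1:ℝ)) k
  refine ⟨∑ i, C i, Finset.sum_nonneg fun i _ => hC i, fun x => ?_⟩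
  unfold euclLap
  rw [Finset.sum_mul]
  exact (Finset.abs_sum_le_sum_abs _ _).trans (Finset.sum_le_sum fun i _ => h i x)

lemma aux_lap_cont {N : ℕ} (f : EuclideanSpace ℝ (Fin N) → ℝ) (hf : ContDiff ℝ (⊤ : ℕ∞) f) :
    Continuous (euclLap N f) := by
  unfold euclLap
  refine continuous_finsetSum _ fun i _ => ?_
  have := hf.continuous_iteratedFDeriv (m := 2) (by norm_cast)
  fun_prop

/-- Unscaled test functions. -/
lemma aux_exists (N : ℕ) (p : ℝ) (hp : 1 < p) :
    ∃ (A : EuclideanSpace ℝ (Fin N) → ℝ) (B : ℝ → ℝ) (C : ℝ), 0 < C ∧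
      ContDiff ℝ (⊤ : ℕ∞) A ∧ ContDiff ℝ (⊤ : ℕ∞) B ∧
      (∀ x, 0 ≤ A x ∧ A x ≤ 1) ∧ (∀ t, 0 ≤ B t ∧ B t ≤ 1) ∧
      (∀ x, ‖x‖ ≤ 1 → A x = 1) ∧ (∀ x, 2 ≤ ‖x‖ → A x = 0) ∧
      B 0 = 1 ∧ (∀ t, 1 ≤ |t| → B t = 0) ∧
      (∀ x, |euclLap N A x| ≤ C * A x ^ (1/p)) ∧ (∀ t, |deriv B t| ≤ C * B t ^ (1/p)) := by
  obtain ⟨k, hk⟩ := exists_nat_ge (2 / (p - 1))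
  have hp1 : 0 < p - 1 := by linarith
  have hkk : ((k + 2 : ℕ) : ℝ) * (1/p) ≤ k := by
    rw [div_le_iff₀ hp1] at hk
    push_cast
    rw [mul_one_div, div_le_iff₀ (by linarith)]
    linarith
  have hpow : ∀ s : ℝ, 0 ≤ s → s ≤ 1 → s ^ k ≤ (s ^ (k+2)) ^ (1/p) := by
    intro s h0 h1
    rw [← Real.rpow_natCast s (k+2), ← Real.rpow_mul h0, ← Real.rpow_natCast s k]
    exact Real.rpow_le_rpow_of_exponent_ge' h0 h1 (by positivity) hkk
  let a : ContDiffBump (0 : EuclideanSpace ℝ (Fin N)) := ⟨1, 2, by norm_num, by norm_num⟩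
  let b : ContDiffBump (0 : ℝ) := ⟨1/4, 1/2, by norm_num, by norm_num⟩
  have hb' : ContDiff ℝ (⊤ : ℕ∞) (b : ℝ → ℝ) := b.contDiff
  obtain ⟨C1, hC1, h1⟩ := aux_lap (a : _ → ℝ) a.contDiff a.hasCompactSupport
    (fun x => a.nonneg) (fun x => a.le_one) k
  obtain ⟨C2, hC2, h2⟩ := aux_pow_d (b : ℝ → ℝ) b.contDiff b.hasCompactSupport
    (fun x => b.nonneg) 1 (k+1)
  refine ⟨fun x => a x ^ (k+2), fun t => b t ^ (k+2), C1 + C2 + 1, by positivity,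
    a.contDiff.pow _, hb'.pow _, 
    fun x => ⟨pow_nonneg a.nonneg _, pow_le_one₀ a.nonneg a.le_one⟩,
    fun x => ⟨pow_nonneg b.nonneg _, pow_le_one₀ b.nonneg b.le_one⟩, ?_, ?_, ?_, ?_, ?_, ?_⟩
  · intro x hx
    have : a x = 1 := a.one_of_mem_closedBall (by simpa using hx)
    simp [this]
  · intro x hx
    have : a x = 0 := a.zero_of_le_dist (by simpa using hx)
    simp [this]
  · have : b 0 = 1 := b.one_of_mem_closedBall (by simp [b])
    simp [this]
  · intro x hx
    have : b x = 0 := b.zero_of_le_dist (by simp [b]; linarith)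
    simp [this]
  · intro x
    refine (h1 x).trans ?_
    have := hpow (a x) a.nonneg a.le_one
    have h3 : 0 ≤ a x ^ k := pow_nonneg a.nonneg _
    gcongr
    linarith
  · intro x
    have h4 := h2 x
    rw [fderiv_apply_one_eq_deriv] at h4
    refine h4.trans ?_
    have h5 := hpow (b x) b.nonneg b.le_one
    have h6 : b x ^ (k+1) ≤ b x ^ k := pow_le_pow_of_le_one b.nonneg b.le_one (by simp)
    have h3 : 0 ≤ b x ^ (k+1) := pow_nonneg b.nonneg _
    have h7 := h6.trans h5
    gcongr
    linarith

lemma aux_young_s2 (p : ℝ) (hp : 1 < p) (u f M : ℝ) (hu : 0 ≤ u) (hf : 0 ≤ f) (hM : 0 ≤ M) :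
    u * (M * f ^ (1/p)) ≤ u ^ p * f + M ^ (p / (p-1)) := by
  have hpq : p.HolderConjugate (p / (p-1)) := Real.HolderConjugate.conjExponent hp
  have h := Real.young_inequality_of_nonneg (a := u * f ^ (1/p)) (b := M) (by positivity) hM hpq
  rw [Real.mul_rpow hu (by positivity), ← Real.rpow_mul hf, one_div_mul_cancel (by linarith),
    Real.rpow_one] at h
  have h1 : u ^ p * f / p ≤ u ^ p * f := div_le_self (by positivity) hp.le
  have h2 : M ^ (p/(p-1)) / (p/(p-1)) ≤ M ^ (p/(p-1)) :=
    div_le_self (by positivity) hpq.symm.lt.le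
  calc _ = u * f ^ (1/p) * M := by ring
    _ ≤ _ := by linarith

/-- Necessary condition on the initial data for the existence of a very weak supersolution
of the semilinear heat equation `∂_t u - Δu = u^p`, in the non-critical case `p ≠ 1 + 2/N`. -/
theorem stmt_2 (N : ℕ) (hN : 1 ≤ N) (p : ℝ) (hp : 1 < p) (hpF : p ≠ 1 + 2 / N) :
    ∃ γ : ℝ, 0 < γ ∧ ∀ T : ℝ, 0 < T →
      ∀ μ : Measure (EuclideanSpace ℝ (Fin N)), IsFiniteMeasureOnCompacts μ →
      (∃ u, IsVeryWeakSupersolutionHeat N p T μ u) →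
      ∀ z : EuclideanSpace ℝ (Fin N), ∀ σ : ℝ, 0 < σ → σ < T ^ ((1:ℝ)/2) →
        μ (Metric.ball z σ) ≤ ENNReal.ofReal (γ * σ ^ ((N:ℝ) - 2 / (p - 1))) := by
  obtain ⟨A, B, C, hC, hA, hB, hA01, hB01, hA1, hA0, hB1, hB0, hLA, hDB⟩ := aux_exists N p hp
  set V : ℝ := volume.real (Metric.closedBall (0 : EuclideanSpace ℝ (Fin N)) 2) with hV
  have hV0 : 0 ≤ V := measureReal_nonneg
  refine ⟨(2 * C) ^ (p / (p-1)) * V + 1, by positivity, ?_⟩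
  rintro T hT μ hμ ⟨u, hum, hu0, hui, hw⟩ z σ hσ hσT
  have hσ2 : σ ^ 2 < T := by
    have := pow_lt_pow_left₀ hσT hσ.le (n := 2) (by norm_num)
    rwa [← Real.rpow_natCast (T ^ _), ← Real.rpow_mul hT.le,
      show (1:ℝ)/2 * ((2:ℕ):ℝ) = 1 by norm_num, Real.rpow_one] at this
  have hτ : σ ^ 2 ∈ Ioo (0:ℝ) T := ⟨by positivity, hσ2⟩
  set A' : EuclideanSpace ℝ (Fin N) → ℝ := fun x => A (σ⁻¹ • (x - z)) with hA'
  set B' : ℝ → ℝ := fun t => B ((σ^2)⁻¹ * t) with hB'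
  set K := Metric.closedBall z (2 * σ) with hK
  have hKc : IsCompact K := isCompact_closedBall _ _
  have hA's : ContDiff ℝ (⊤ : ℕ∞) A' := by fun_prop
  have hB's : ContDiff ℝ (⊤ : ℕ∞) B' := by fun_prop
  have hA'K : ∀ x, x ∉ K → A' x = 0 := by
    intro x hx
    apply hA0
    rw [hK, Metric.mem_closedBall, not_le, dist_eq_norm] at hx
    rw [norm_smul, norm_inv, Real.norm_of_nonneg hσ.le, ← div_eq_inv_mul, le_div_iff₀ hσ]
    exact hx.le
  have hB'K : ∀ t, t ∉ Icc (-σ^2) (σ^2) → B' t = 0 := by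
    intro t ht
    apply hB0
    rw [mem_Icc, ← abs_le, not_le] at ht
    rw [abs_mul, abs_inv, abs_of_pos (by positivity : 0 < σ^2), ← div_eq_inv_mul,
      le_div_iff₀ (by positivity)]
    linarith
  have hA'1 : ∀ x ∈ Metric.ball z σ, A' x = 1 := by
    intro x hx
    apply hA1
    rw [Metric.mem_ball, dist_eq_norm] at hx
    rw [norm_smul, norm_inv, Real.norm_of_nonneg hσ.le, ← div_eq_inv_mul, div_le_iff₀ hσ]
    linarith
  have hA'0 : ∀ x, 0 ≤ A' x ∧ A' x ≤ 1 := fun x => hA01 _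
  have hB'0 : ∀ x, 0 ≤ B' x ∧ B' x ≤ 1 := fun x => hB01 _
  have hB'z : B' 0 = 1 := by simp [hB', hB1]
  have hA'c : HasCompactSupport A' := HasCompactSupport.intro hKc hA'K
  set M := 2 * C * (σ^2)⁻¹ with hM
  have hM0 : 0 ≤ M := by positivity
  -- derivative formulas
  have hder : ∀ x t, deriv (fun s => A' x * B' s) t = A' x * ((σ^2)⁻¹ * deriv B ((σ^2)⁻¹ * t)) := by
    intro x t
    rw [deriv_const_mul_field]
    congr 1
    have := deriv_comp_mul_left ((σ^2)⁻¹) B t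
    simpa using this
  have hlap : ∀ x t, euclLap N (fun y => A' y * B' t) x
      = B' t * ((σ^2)⁻¹ * euclLap N A (σ⁻¹ • (x - z))) := by
    intro x t
    have h1 := aux_scale A hA z x σ⁻¹
    rw [inv_pow] at h1
    rw [← h1]
    unfold euclLap
    rw [Finset.mul_sum]
    refine Finset.sum_congr rfl fun i _ => ?_
    have e0 : (fun y => A' y * B' t) = B' t • A' := by
      funext y; simp [mul_comm]
    rw [e0, iteratedFDeriv_const_smul_apply (hA's.contDiffAt.of_le (by norm_cast))]
    rfl
  set g : EuclideanSpace ℝ (Fin N) × ℝ → ℝ := fun q =>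
    -(deriv (fun s => A' q.1 * B' s) q.2) - euclLap N (fun y => A' y * B' q.2) q.1 with hg
  have hgc : Continuous g := by
    simp only [hg, hder, hlap]
    have h1 := aux_lap_cont A hA
    have h2 : Continuous (deriv B) := hB.continuous_deriv (by simp)
    have h3 := hA's.continuous
    have h4 := hB's.continuous
    fun_prop
  have hgb : ∀ q, |g q| ≤ M * (A' q.1 * B' q.2) ^ (1/p) := by
    rintro ⟨x, t⟩
    simp only [hg, hder, hlap]
    have h1 : |euclLap N A (σ⁻¹ • (x - z))| ≤ C * A' x ^ (1/p) := hLA _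
    have h2 : |deriv B ((σ^2)⁻¹ * t)| ≤ C * B' t ^ (1/p) := hDB _
    have hp1 : 1 / p ≤ 1 := by rw [div_le_one (by linarith)]; exact hp.le
    have self : ∀ s : ℝ, 0 ≤ s ∧ s ≤ 1 → s ≤ s ^ (1/p) := fun s hs => by
      have := Real.rpow_le_rpow_of_exponent_ge' hs.1 hs.2 (by positivity : 0 ≤ 1/p) hp1
      rwa [Real.rpow_one] at this
    have h3 := self _ (hA'0 x)
    have h4 := self _ (hB'0 t)
    have hAx := (hA'0 x).1
    have hBt := (hB'0 t).1
    rw [Real.mul_rpow hAx hBt]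
    have s2 : 0 ≤ (σ^2)⁻¹ := by positivity
    calc _ ≤ |A' x * ((σ^2)⁻¹ * deriv B ((σ^2)⁻¹ * t))|
          + |B' t * ((σ^2)⁻¹ * euclLap N A (σ⁻¹ • (x - z)))| := by
            refine (abs_sub _ _).trans ?_
            rw [abs_neg]
      _ = A' x * ((σ^2)⁻¹ * |deriv B ((σ^2)⁻¹ * t)|)
          + B' t * ((σ^2)⁻¹ * |euclLap N A (σ⁻¹ • (x - z))|) := by
            simp only [abs_mul, abs_of_nonneg hAx, abs_of_nonneg hBt, abs_of_nonneg s2]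
      _ ≤ A' x ^ (1/p) * ((σ^2)⁻¹ * (C * B' t ^ (1/p)))
          + B' t ^ (1/p) * ((σ^2)⁻¹ * (C * A' x ^ (1/p))) := by gcongr
      _ = _ := by rw [hM]; ring
  have hφ0 : ∀ x t, 0 ≤ A' x * B' t := fun x t => mul_nonneg (hA'0 x).1 (hB'0 t).1
  have hφ1 : ∀ x t, A' x * B' t ≤ 1 := fun x t => mul_le_one₀ (hA'0 x).2 (hB'0 t).1 (hB'0 t).2
  have hgM : ∀ q, ‖g q‖ ≤ M := by
    intro q
    refine (hgb q).trans ?_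
    have := Real.rpow_le_one (hφ0 q.1 q.2) (hφ1 q.1 q.2) (by positivity : 0 ≤ 1/p)
    nlinarith
  have hgK : ∀ x t, x ∉ K → g (x, t) = 0 := by
    intro x t hx
    have := hgb (x, t)
    simp only [hA'K x hx, zero_mul] at this
    rw [Real.zero_rpow (by positivity), mul_zero] at this
    exact abs_nonpos_iff.1 this
  have main := hw (σ^2) hτ (fun x t => A' x * B' t) (by
      have : Function.uncurry (fun x t => A' x * B' t) = fun q => A' q.1 * B' q.2 := rfl
      rw [this]; fun_prop)
    (by
      refine HasCompactSupport.intro (hKc.prod (isCompact_Icc (a := -σ^2) (b := σ^2))) ?_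
      rintro ⟨x, t⟩ hxt
      simp only [Function.uncurry]
      by_cases hx : x ∈ K
      · rw [hB'K t (fun h => hxt ⟨hx, h⟩), mul_zero]
      · rw [hA'K x hx, zero_mul])
    hφ0 (by
      intro x
      have : B' (σ^2) = 0 := by
        apply hB0
        rw [inv_mul_cancel₀ (by positivity), abs_one]
      rw [this, mul_zero])
  obtain ⟨hi1, hi2⟩ := hui K hKc (σ^2) hτ
  have hres : (volume : Measure (EuclideanSpace ℝ (Fin N) × ℝ)).restrict (K ×ˢ Ioo (0:ℝ) (σ^2))
      = (volume.restrict K).prod (volume.restrict (Ioo (0:ℝ) (σ^2))) := by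
    rw [Measure.prod_restrict]; rfl
  have hI1 : IntegrableOn (fun q : EuclideanSpace ℝ (Fin N) × ℝ => u q.1 q.2 * g q)
      (K ×ˢ Ioo (0:ℝ) (σ^2)) :=
    Integrable.mul_bdd (c := M) hi1 hgc.aestronglyMeasurable (Filter.Eventually.of_forall hgM)
  have hI2 : IntegrableOn (fun q : EuclideanSpace ℝ (Fin N) × ℝ => u q.1 q.2 ^ p * (A' q.1 * B' q.2))
      (K ×ˢ Ioo (0:ℝ) (σ^2)) := by
    refine Integrable.mul_bdd (c := 1) hi2 ?_ (Filter.Eventually.of_forall ?_)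
    · have h3 := hA's.continuous
      have h4 := hB's.continuous
      exact (by fun_prop : Continuous fun q : EuclideanSpace ℝ (Fin N) × ℝ =>
        A' q.1 * B' q.2).aestronglyMeasurable
    · intro q
      rw [Real.norm_of_nonneg (hφ0 _ _)]
      exact hφ1 _ _
  have conv : ∀ F : EuclideanSpace ℝ (Fin N) → ℝ → ℝ, (∀ x t, x ∉ K → F x t = 0) →
      IntegrableOn (fun q : EuclideanSpace ℝ (Fin N) × ℝ => F q.1 q.2) (K ×ˢ Ioo (0:ℝ) (σ^2)) →
      ∫ t in Ioo (0:ℝ) (σ^2), ∫ x, F x t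
        = ∫ q in K ×ˢ Ioo (0:ℝ) (σ^2), F q.1 q.2 := by
    intro F hF hFi
    unfold IntegrableOn at hFi
    rw [hres] at hFi ⊢
    rw [integral_prod_symm _ hFi]
    congr 1
    funext t
    exact (setIntegral_eq_integral_of_forall_compl_eq_zero (fun x hx => hF x t hx)).symm
  have c1 := conv (fun x t => u x t * g (x, t)) (fun x t hx => by simp [hgK x t hx]) hI1
  have c2 := conv (fun x t => u x t ^ p * (A' x * B' t)) (fun x t hx => by simp [hA'K x hx]) hI2
  have hvol : volume.real (K ×ˢ Ioo (0:ℝ) (σ^2)) = σ ^ N * V * σ ^ 2 := by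
    rw [Measure.volume_eq_prod, measureReal_prod_prod, Real.volume_real_Ioo_of_le (by positivity),
      sub_zero, hK, hV, measureReal_def, measureReal_def,
      Measure.addHaar_closedBall volume z (by positivity),
      Measure.addHaar_closedBall volume (0 : EuclideanSpace ℝ (Fin N)) (by positivity)]
    rw [ENNReal.toReal_mul, ENNReal.toReal_mul, ENNReal.toReal_ofReal (by positivity),
      ENNReal.toReal_ofReal (by positivity), finrank_euclideanSpace_fin]
    ring
  have hfin : volume (K ×ˢ Ioo (0:ℝ) (σ^2)) ≠ ⊤ := by
    rw [Measure.volume_eq_prod, Measure.prod_prod]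
    exact ENNReal.mul_ne_top hKc.measure_lt_top.ne (by simp)
  have hms : MeasurableSet (K ×ˢ Ioo (0:ℝ) (σ^2)) := hKc.measurableSet.prod measurableSet_Ioo
  have hcmp : ∫ q in K ×ˢ Ioo (0:ℝ) (σ^2), u q.1 q.2 * g q
      ≤ (∫ q in K ×ˢ Ioo (0:ℝ) (σ^2), u q.1 q.2 ^ p * (A' q.1 * B' q.2))
        + σ ^ N * V * σ ^ 2 * M ^ (p/(p-1)) := by
    have hconst : IntegrableOn (fun _ : EuclideanSpace ℝ (Fin N) × ℝ => M ^ (p/(p-1)))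
      (K ×ˢ Ioo (0:ℝ) (σ^2)) := integrableOn_const hfin
    rw [← hvol, ← smul_eq_mul (volume.real _), ← setIntegral_const, ← integral_add hI2 hconst]
    refine setIntegral_mono_on hI1 (hI2.add hconst) hms ?_
    rintro ⟨x, t⟩ ⟨hx, ht⟩
    have hu := hu0 x t ⟨ht.1, ht.2.trans hσ2⟩
    refine le_trans ?_ (aux_young_s2 p hp (u x t) (A' x * B' t) M hu (hφ0 x t) hM0)
    exact mul_le_mul_of_nonneg_left ((le_abs_self _).trans (hgb (x, t))) hu
  have hμA : ∫ x, A' x ∂μ ≤ σ ^ N * V * σ ^ 2 * M ^ (p/(p-1)) := by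
    simp only [hB'z, mul_one] at main
    have main' := main
    rw [c2] at main'
    have c1' : (∫ t in Ioo (0:ℝ) (σ^2), ∫ x,
        u x t * (-(deriv (fun s => A' x * B' s) t) - euclLap N (fun y => A' y * B' t) x)) =
        ∫ q in K ×ˢ Ioo (0:ℝ) (σ^2), u q.1 q.2 * g q := c1
    rw [c1'] at main'
    linarith
  have hball : μ.real (Metric.ball z σ) ≤ ∫ x, A' x ∂μ := by
    have hAi : Integrable A' μ := hA's.continuous.integrable_of_hasCompactSupport hA'c
    rw [← integral_indicator_one measurableSet_ball]
    refine integral_mono_of_nonneg (Filter.Eventually.of_forall fun x => ?_) hAi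
      (Filter.Eventually.of_forall fun x => ?_)
    · exact indicator_nonneg (fun _ _ => zero_le_one) _
    · by_cases hx : x ∈ Metric.ball z σ
      · simp [hx, hA'1 x hx]
      · simp only [hx, not_false_eq_true, indicator_of_notMem]; exact (hA'0 x).1
  have hexp : σ ^ N * V * σ ^ 2 * M ^ (p/(p-1))
      = (2 * C) ^ (p / (p-1)) * V * σ ^ ((N:ℝ) - 2 / (p - 1)) := by
    rw [hM, Real.mul_rpow (by positivity) (by positivity), Real.inv_rpow (by positivity),
      ← Real.rpow_natCast σ 2, ← Real.rpow_mul hσ.le, ← Real.rpow_neg hσ.le,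
      ← Real.rpow_natCast σ N]
    have hp1 : p - 1 ≠ 0 := by linarith
    have : (N:ℝ) - 2/(p-1) = N + (2:ℕ) + -((2:ℕ) * (p/(p-1))) := by
      push_cast; field_simp; ring
    rw [this, Real.rpow_add hσ, Real.rpow_add hσ]
    ring
  have hfb : μ (Metric.ball z σ) ≠ ⊤ := measure_ball_lt_top.ne
  rw [← ENNReal.ofReal_toReal hfb]
  refine ENNReal.ofReal_le_ofReal ?_
  have hs : 0 ≤ σ ^ ((N:ℝ) - 2 / (p - 1)) := by positivity
  calc _ ≤ _ := hball
    _ ≤ _ := hμA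
    _ = _ := hexp
    _ ≤ _ := by nlinarith
end

section
/- Let N ≥ 1 be an integer, p = 1 + 2/N, and T ∈ (0,∞). There exists a constant γ > 0 depending only on N such that: if μ is a nonnegative Radon measure on ℝ^N and there exists a very weak supersolution u of ∂_t u − Δu = u^p with initial data μ on ℝ^N × [0,T), then μ(B(z,σ)) ≤ γ [log(e + T^{1/2}/σ)]^{−N/2} for every z ∈ ℝ^N and every σ ∈ (0, T^{1/2}). -/
open MeasureTheory Real Set

lemma st_bdd (g : ℝ → ℝ) (hg : Continuous g) (h0 : ∀ s, s < 0 → g s = 0) (h1 : ∀ s, 1 < s → g s = 0) :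
    ∃ M, 0 ≤ M ∧ ∀ s, |g s| ≤ M := by
  obtain ⟨M, hM⟩ := (isCompact_Icc (a := (0:ℝ)) (b := 1)).exists_bound_of_continuousOn hg.continuousOn
  refine ⟨max M 0, le_max_right _ _, fun s => ?_⟩
  by_cases h : s ∈ Icc (0:ℝ) 1
  · exact (hM s h).trans (le_max_left _ _)
  · rw [mem_Icc, not_and_or, not_le, not_le] at h
    rcases h with h | h
    · simp [h0 s h]
    · simp [h1 s h]

lemma st_profile (N : ℕ) : ∃ M, 0 < M ∧ ∀ s : ℝ,
    |deriv (fun s => Real.smoothTransition s ^ (N+2)) s| ≤ M * Real.smoothTransition s ^ N ∧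
    |deriv (deriv (fun s => Real.smoothTransition s ^ (N+2))) s| ≤ M * Real.smoothTransition s ^ N := by
  set H := Real.smoothTransition with hH
  have hs : ContDiff ℝ 3 H := Real.smoothTransition.contDiff
  have hd : Differentiable ℝ H := hs.differentiable (by norm_num)
  have hs1 : ContDiff ℝ 2 (deriv H) := by
    have : ContDiff ℝ (2+1) H := by simpa using hs.of_le (by norm_num)
    exact (contDiff_succ_iff_deriv.1 this).2.2
  have hd1 : Differentiable ℝ (deriv H) := hs1.differentiable (by norm_num)
  have hs2 : ContDiff ℝ 1 (deriv (deriv H)) := by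
    have : ContDiff ℝ (1+1) (deriv H) := by simpa using hs1.of_le (by norm_num)
    exact (contDiff_succ_iff_deriv.1 this).2.2
  have e0 : ∀ s, s < 0 → H =ᶠ[nhds s] fun _ => 0 := fun s h => by
    filter_upwards [Iio_mem_nhds h] with x hx
    exact Real.smoothTransition.zero_of_nonpos (le_of_lt hx)
  have e1 : ∀ s, 1 < s → H =ᶠ[nhds s] fun _ => 1 := fun s h => by
    filter_upwards [Ioi_mem_nhds h] with x hx
    exact Real.smoothTransition.one_of_one_le (le_of_lt hx)
  obtain ⟨M1, hM1, hb1⟩ := st_bdd (deriv H) hs1.continuous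
    (fun s h => by rw [(e0 s h).deriv_eq]; simp) (fun s h => by rw [(e1 s h).deriv_eq]; simp)
  obtain ⟨M2, hM2, hb2⟩ := st_bdd (deriv (deriv H)) hs2.continuous
    (fun s h => by rw [(e0 s h).deriv.deriv_eq]; simp) (fun s h => by rw [(e1 s h).deriv.deriv_eq]; simp)
  have hP1 : deriv (fun s => H s ^ (N+2)) = fun s => (N+2) * H s ^ (N+1) * deriv H s := by
    funext s
    have := ((hd s).hasDerivAt.pow (N+2)).deriv
    simp at this
    exact this
  have hP2 : deriv (deriv (fun s => H s ^ (N+2))) = fun s => (N+2) * ((N+1) * H s ^ N * deriv H s) * deriv H s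
      + (N+2) * H s ^ (N+1) * deriv (deriv H) s := by
    rw [hP1]
    funext s
    have := ((((hd s).hasDerivAt.pow (N+1)).const_mul ((N:ℝ)+2)).mul (hd1 s).hasDerivAt).deriv
    simp at this
    exact this
  refine ⟨(N+2) * M1 + (N+2)*(N+1)*M1*M1 + (N+2)*M2 + 1, by positivity, fun s => ?_⟩
  have h0 : 0 ≤ H s := Real.smoothTransition.nonneg s
  have h1 : H s ≤ 1 := Real.smoothTransition.le_one s
  have hN0 : 0 ≤ H s ^ N := by positivity
  have hle : H s ^ (N+1) ≤ H s ^ N := pow_le_pow_of_le_one h0 h1 (by omega)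
  have hle0 : 0 ≤ H s ^ (N+1) := by positivity
  have A1 : |(N+2) * H s ^ (N+1) * deriv H s| ≤ (N+2) * H s ^ N * M1 := by
    rw [abs_mul, abs_of_nonneg (by positivity)]
    gcongr; exact hb1 s
  have A2 : |(N+2) * H s ^ (N+1) * deriv (deriv H) s| ≤ (N+2) * H s ^ N * M2 := by
    rw [abs_mul, abs_of_nonneg (by positivity)]
    gcongr; exact hb2 s
  have A3 : |(N+2) * ((N+1) * H s ^ N * deriv H s) * deriv H s| ≤ (N+2) * ((N+1) * H s ^ N * M1) * M1 := by
    rw [abs_mul, abs_mul, abs_mul, abs_of_nonneg (a := (N:ℝ)+2) (by positivity), abs_of_nonneg (a := ((N:ℝ)+1) * H s ^ N) (by positivity)]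
    gcongr <;> exact hb1 s
  rw [hP2, hP1]
  have q1 : 0 ≤ (N+2) * H s ^ N * M1 := by positivity
  have q2 : 0 ≤ (N+2) * H s ^ N * M2 := by positivity
  have q3 : 0 ≤ (N+2) * ((N+1) * H s ^ N * M1) * M1 := by positivity
  constructor
  · nlinarith
  · refine (abs_add_le _ _).trans ?_
    nlinarith

lemma lap_formula (N : ℕ) (Φ : ℝ → ℝ) (hΦ : ContDiff ℝ 2 Φ) (c : ℝ) (hc : 0 < c)
    (z x : EuclideanSpace ℝ (Fin N)) :
    euclLap N (fun y => Φ (Real.log (‖y - z‖^2 + c))) x =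
      deriv (deriv Φ) (Real.log (‖x - z‖^2 + c)) * (4 * ‖x - z‖^2 / (‖x - z‖^2 + c)^2)
      + deriv Φ (Real.log (‖x - z‖^2 + c)) *
        (2 * N / (‖x - z‖^2 + c) - 4 * ‖x - z‖^2 / (‖x - z‖^2 + c)^2) := by
  have hpos : ∀ y : EuclideanSpace ℝ (Fin N), 0 < ‖y - z‖^2 + c := fun y => by positivity
  have hd : Differentiable ℝ Φ := hΦ.differentiable (by norm_num)
  have hd1 : Differentiable ℝ (deriv Φ) := by
    have : ContDiff ℝ (1+1) Φ := by simpa using hΦ.of_le (by norm_num)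
    exact ((contDiff_succ_iff_deriv.1 this).2.2).differentiable (by norm_num)
  have hq : ∀ y, HasFDerivAt (fun y : EuclideanSpace ℝ (Fin N) => ‖y - z‖^2 + c)
      ((2:ℝ) • innerSL ℝ (y - z)) y := fun y => by
    have := (((hasFDerivAt_id y).sub_const z).norm_sq).add_const c
    have e : (2:ℕ) • (innerSL ℝ (id y - z)).comp (ContinuousLinearMap.id ℝ (EuclideanSpace ℝ (Fin N)))
        = (2:ℝ) • innerSL ℝ (y - z) := by
      ext v
      simp
    exact e ▸ this
  have hlog := fun y => (hq y).log (hpos y).ne'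
  have h1 : fderiv ℝ (fun y => Φ (Real.log (‖y - z‖^2 + c))) = fun y =>
      (deriv Φ (Real.log (‖y - z‖^2 + c)) * (‖y - z‖^2 + c)⁻¹ * 2) • innerSL ℝ (y - z) := by
    funext y
    have := ((hd _).hasDerivAt.comp_hasFDerivAt y (hlog y)).fderiv
    rw [show (fun y => Φ (Real.log (‖y - z‖^2 + c))) = Φ ∘ (fun y => (Real.log (‖y - z‖^2 + c))) from rfl, this]
    simp only [smul_smul, mul_assoc]
  have hA := ((((hd1 _).hasDerivAt.comp_hasFDerivAt x (hlog x)).mul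
    ((hasDerivAt_inv (hpos x).ne').comp_hasFDerivAt x (hq x))).mul_const 2).smul
    ((innerSL (E := EuclideanSpace ℝ (Fin N)) ℝ).hasFDerivAt.comp x ((hasFDerivAt_id x).sub_const z))
  have h2 := hA.fderiv
  unfold euclLap
  simp only [iteratedFDeriv_two_apply, h1]
  have h3 : ∀ v : EuclideanSpace ℝ (Fin N), fderiv ℝ (fun y =>
      (deriv Φ (Real.log (‖y - z‖^2 + c)) * (‖y - z‖^2 + c)⁻¹ * 2) • innerSL ℝ (y - z)) x v v
      = (deriv (deriv Φ) (Real.log (‖x - z‖^2 + c)) * (4 / (‖x - z‖^2 + c)^2)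
         - deriv Φ (Real.log (‖x - z‖^2 + c)) * (4 / (‖x - z‖^2 + c)^2)) * (inner ℝ (x - z) v)^2
        + deriv Φ (Real.log (‖x - z‖^2 + c)) * (2 / (‖x - z‖^2 + c)) * ‖v‖^2 := by
    intro v
    have h4 := congrArg (fun L => L v v) h2
    refine Eq.trans h4 ?_
    have := (hpos x).ne'
    have hv : inner ℝ v v = ‖v‖^2 := real_inner_self_eq_norm_sq v
    change (deriv Φ (Real.log (‖x - z‖^2 + c)) * (‖x - z‖^2 + c)⁻¹ * 2) * inner ℝ v v +
      (2 * (deriv Φ (Real.log (‖x - z‖^2 + c)) * (-((‖x - z‖^2 + c)^2)⁻¹ * (2 * inner ℝ (x - z) v))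
        + (‖x - z‖^2 + c)⁻¹ * (deriv (deriv Φ) (Real.log (‖x - z‖^2 + c)) * ((‖x - z‖^2 + c)⁻¹ *
          (2 * inner ℝ (x - z) v))))) * inner ℝ (x - z) v = _
    rw [hv]
    field_simp
    ring
  have hn : ‖x - z‖^2 = ∑ i, (x i - z i)^2 := by
    simp [EuclideanSpace.norm_sq_eq]
  simp only [Matrix.cons_val_zero, Matrix.cons_val_one, h3]
  rw [Finset.sum_add_distrib, ← Finset.mul_sum]
  simp only [EuclideanSpace.inner_single_right, EuclideanSpace.norm_single]
  have hn2 : ∑ i, ((1:ℝ) * (starRingEnd ℝ) ((x - z) i))^2 = ‖x - z‖^2 := by simp [hn]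
  rw [hn2]
  simp
  ring

lemma int_kernel (N : ℕ) : ∃ C, 0 < C ∧ ∀ (z : EuclideanSpace ℝ (Fin N)) (s : ℝ), 0 < s →
    Integrable (fun x => (‖x - z‖^2 + s) ^ (-(1 + (N:ℝ)/2))) ∧
    ∫ x, (‖x - z‖^2 + s) ^ (-(1 + (N:ℝ)/2)) ≤ C / s := by
  set f : EuclideanSpace ℝ (Fin N) → ℝ := fun x => (1 + ‖x‖^2) ^ (-((2:ℝ) + N)/2) with hf
  have hfi : Integrable f := by
    apply integrable_rpow_neg_one_add_norm_sq
    simp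
  have hf0 : 0 ≤ ∫ x, f x := integral_nonneg fun x => by positivity
  refine ⟨(∫ x, f x) + 1, by positivity, fun z s hs => ?_⟩
  have hr : 0 < Real.sqrt s := Real.sqrt_pos.2 hs
  have key : (fun x => (‖x - z‖^2 + s) ^ (-(1 + (N:ℝ)/2))) =
      fun x => s ^ (-(1 + (N:ℝ)/2)) * f ((Real.sqrt s)⁻¹ • (x - z)) := by
    funext x
    simp only [hf]
    rw [show -((2:ℝ) + N)/2 = -(1 + (N:ℝ)/2) by ring, ← Real.mul_rpow hs.le (by positivity), norm_smul, mul_pow]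
    congr 1
    simp [Real.sq_sqrt hs.le]
    field_simp
    ring
  rw [key]
  constructor
  · exact (((integrable_comp_smul_iff volume f (inv_ne_zero hr.ne')).2 hfi).comp_sub_right z).const_mul _
  · rw [integral_const_mul, integral_sub_right_eq_self (fun x => f ((Real.sqrt s)⁻¹ • x)), Measure.integral_comp_smul]
    simp only [finrank_euclideanSpace_fin, smul_eq_mul]
    have : |(((Real.sqrt s)⁻¹ ^ N)⁻¹)| = s ^ ((N:ℝ)/2) := by
      rw [abs_of_nonneg (by positivity), inv_pow, inv_inv, Real.sqrt_eq_rpow, ← Real.rpow_mul_natCast hs.le]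
      congr 1; ring
    rw [this, ← mul_assoc, ← Real.rpow_add hs, show -(1 + (N:ℝ)/2) + N/2 = -1 by ring, Real.rpow_neg_one]
    rw [div_eq_inv_mul]
    gcongr; linarith

lemma test_fun (N : ℕ) (hN : 1 ≤ N) : ∃ M0 : ℝ, 0 < M0 ∧ ∀ (T σ L : ℝ) (z : EuclideanSpace ℝ (Fin N)),
    0 < T → 0 < σ → L = Real.log (16 * T / σ^2) / 2 → 1 ≤ L →
    ∃ φ η : EuclideanSpace ℝ (Fin N) → ℝ → ℝ,
      ContDiff ℝ (⊤ : ℕ∞) (Function.uncurry φ) ∧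
      HasCompactSupport (Function.uncurry φ) ∧
      (∀ x, φ x (T/2) = 0) ∧
      (∀ x ∈ Metric.ball z σ, φ x 0 = 1) ∧
      (∀ x t, 0 ≤ η x t ∧ η x t ≤ 1) ∧
      (∀ x t, φ x t = η x t ^ (N+2)) ∧
      Continuous (fun q : EuclideanSpace ℝ (Fin N) × ℝ =>
        -(deriv (φ q.1) q.2) - euclLap N (fun y => φ y q.2) q.1) ∧
      (∀ x t, |-(deriv (φ x) t) - euclLap N (fun y => φ y t) x| ≤
        η x t ^ N * (M0 / L / (‖x - z‖^2 + Real.sqrt (4096 * t^2 + σ^4)))) ∧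
      (∃ K : Set (EuclideanSpace ℝ (Fin N)), IsCompact K ∧ ∀ x, x ∉ K → ∀ t, η x t = 0) := by
  obtain ⟨M, hM, hb⟩ := st_profile N
  refine ⟨M * (36 + N), by positivity, fun T σ L z hT hσ hLdef hL => ?_⟩
  set P : ℝ → ℝ := fun s => Real.smoothTransition s ^ (N+2) with hP
  have hPs : ∀ n : ℕ∞, ContDiff ℝ n P := fun n => Real.smoothTransition.contDiff.pow _
  have hPd : Differentiable ℝ P := (hPs 1).differentiable (by norm_num)
  have hPs1 : ContDiff ℝ 1 (deriv P) := by
    have : ContDiff ℝ (1+1) P := by simpa using (hPs 2).of_le (by norm_num)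
    exact (contDiff_succ_iff_deriv.1 this).2.2
  have hPd1 : Differentiable ℝ (deriv P) := hPs1.differentiable (by norm_num)
  set a := Real.log (32 * T) with ha
  set A : ℝ → ℝ := fun w => (a - w) / (2 * L) with hA
  set Φ : ℝ → ℝ := fun w => P (A w) with hΦ
  have hAd : ∀ w, HasDerivAt A (-(1 / (2*L))) w := fun w => by
    have := ((hasDerivAt_id w).const_sub a).div_const (2*L)
    rw [← neg_div]; exact this
  have hL0 : 0 < L := by linarith
  have hΦ1 : deriv Φ = fun w => deriv P (A w) * (-(1/(2*L))) := by
    funext w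
    exact ((hPd _).hasDerivAt.comp w (hAd w)).deriv
  have hΦ2 : deriv (deriv Φ) = fun w => deriv (deriv P) (A w) * (-(1/(2*L))) * (-(1/(2*L))) := by
    rw [hΦ1]; funext w
    exact (((hPd1 _).hasDerivAt.comp w (hAd w)).mul_const _).deriv
  have hAs : ∀ n : ℕ∞, ContDiff ℝ n A := fun n => by
    simp only [hA]; fun_prop
  have hΦs : ∀ n : ℕ∞, ContDiff ℝ n Φ := fun n => (hPs n).comp (hAs n)
  have hcA : Continuous A := (hAs 0).continuous
  have hcΦ1 : Continuous (deriv Φ) := by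
    rw [hΦ1]; exact (hPs1.continuous.comp hcA).mul continuous_const
  have hcΦ2 : Continuous (deriv (deriv Φ)) := by
    rw [hΦ2]
    exact (((hPs1.continuous_deriv le_rfl).comp hcA).mul continuous_const).mul continuous_const
  set s : ℝ → ℝ := fun t => Real.sqrt (4096 * t^2 + σ^4) with hs
  have hin : ∀ t : ℝ, 0 < 4096 * t^2 + σ^4 := fun t => by positivity
  have hspos : ∀ t, 0 < s t := fun t => Real.sqrt_pos.2 (hin t)
  have hsge : ∀ t, 64 * |t| ≤ s t := fun t => by
    apply Real.le_sqrt_of_sq_le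
    rw [mul_pow, sq_abs]; nlinarith [pow_pos hσ 4]
  have hss : ContDiff ℝ (⊤ : ℕ∞) s := by
    apply ContDiff.sqrt
    · fun_prop
    · exact fun t => (hin t).ne'
  have hsd : ∀ t, HasDerivAt s (4096 * t / s t) t := fun t => by
    have h1 : HasDerivAt (fun t : ℝ => 4096 * t^2 + σ^4) (4096 * (2 * t)) t := by
      have := (((hasDerivAt_id t).pow 2).const_mul 4096).add_const (σ^4)
      simpa using this
    have := h1.sqrt (hin t).ne'
    convert this using 1
    have := (hspos t).ne'
    simp only [hs] at this ⊢
    field_simp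
  have hqpos : ∀ (x : EuclideanSpace ℝ (Fin N)) t, 0 < ‖x - z‖^2 + s t := fun x t => by
    have := hspos t; positivity
  set φ : EuclideanSpace ℝ (Fin N) → ℝ → ℝ := fun x t => Φ (Real.log (‖x - z‖^2 + s t)) with hφ
  set η : EuclideanSpace ℝ (Fin N) → ℝ → ℝ := fun x t => Real.smoothTransition (A (Real.log (‖x - z‖^2 + s t))) with hη
  have hη0 : ∀ x t, 32 * T ≤ ‖x - z‖^2 + s t → η x t = 0 := fun x t h => by
    apply Real.smoothTransition.zero_of_nonpos
    have := Real.log_le_log (by positivity) h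
    exact div_nonpos_of_nonpos_of_nonneg (by linarith) (by linarith)
  have hφη : ∀ x t, φ x t = η x t ^ (N+2) := fun x t => rfl
  have hφ0 : ∀ x t, 32 * T ≤ ‖x - z‖^2 + s t → φ x t = 0 := fun x t h => by
    rw [hφη, hη0 x t h]; simp
  have hcs : Continuous s := hss.continuous
  have hdt : ∀ x t, deriv (φ x) t = deriv Φ (Real.log (‖x - z‖^2 + s t)) * ((4096 * t / s t) / (‖x - z‖^2 + s t)) := by
    intro x t
    have h1 := ((hsd t).const_add (‖x - z‖^2)).log (hqpos x t).ne'
    have h2 := ((hΦs 1).differentiable (by norm_num) (Real.log (‖x - z‖^2 + s t))).hasDerivAt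
    exact (h2.comp t h1).deriv
  have hlap : ∀ x t, euclLap N (fun y => φ y t) x = _ := fun x t =>
    lap_formula N Φ (hΦs 2) (s t) (hspos t) z x
  refine ⟨φ, η, ?_, ?_, ?_, ?_, ?_, hφη, ?_, ?_, ?_⟩
  · have h1 : ContDiff ℝ (⊤ : ℕ∞) (fun q : EuclideanSpace ℝ (Fin N) × ℝ => ‖q.1 - z‖^2 + s q.2) :=
      ((contDiff_fst.sub contDiff_const).norm_sq ℝ).add (hss.comp contDiff_snd)
    exact (hΦs ⊤).comp (h1.log fun q => (hqpos q.1 q.2).ne')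
  · refine HasCompactSupport.intro (K := Metric.closedBall z (Real.sqrt (32 * T)) ×ˢ Icc (-T) T)
      ((isCompact_closedBall _ _).prod isCompact_Icc) ?_
    rintro ⟨x, t⟩ hx
    apply hφ0
    rw [mem_prod, not_and_or] at hx
    rcases hx with hx | hx
    · simp only [Metric.mem_closedBall, not_le, dist_eq_norm] at hx
      have := (Real.sqrt_lt' (lt_of_le_of_lt (Real.sqrt_nonneg _) hx)).1 hx
      linarith [hspos t]
    · simp only [mem_Icc, ← abs_le, not_le] at hx
      nlinarith [hsge t, sq_nonneg ‖x - z‖]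
  · intro x
    apply hφ0
    have := hsge (T/2)
    rw [abs_of_pos (by linarith)] at this
    nlinarith [sq_nonneg ‖x - z‖]
  · intro x hx
    have h1 : η x 0 = 1 := by
      apply Real.smoothTransition.one_of_one_le
      rw [Metric.mem_ball, dist_eq_norm] at hx
      have hs0 : s 0 = σ^2 := by
        simp only [hs]
        rw [show 4096 * (0:ℝ)^2 + σ^4 = (σ^2)^2 by ring, Real.sqrt_sq (by positivity)]
      have h2 : ‖x - z‖^2 + s 0 ≤ 2 * σ^2 := by
        rw [hs0]; nlinarith [norm_nonneg (x - z)]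
      have h3 := Real.log_le_log (hqpos x 0) h2
      have h4 : a - Real.log (2 * σ^2) = 2 * L := by
        rw [ha, hLdef, ← Real.log_div (by positivity) (by positivity)]
        rw [show 32 * T / (2 * σ^2) = 16 * T / σ^2 by field_simp; norm_num]
        ring
      simp only [hA]
      rw [le_div_iff₀ (by positivity)]
      linarith
    rw [hφη, h1]; simp
  · exact fun x t => ⟨Real.smoothTransition.nonneg _, Real.smoothTransition.le_one _⟩
  · simp only [hdt, hlap]
    have hcq : Continuous (fun q : EuclideanSpace ℝ (Fin N) × ℝ => ‖q.1 - z‖^2 + s q.2) := by fun_prop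
    have hcl := hcq.log (fun q => (hqpos q.1 q.2).ne')
    have c1 := hcΦ1.comp hcl
    have c2 := hcΦ2.comp hcl
    have hn1 : ∀ q : EuclideanSpace ℝ (Fin N) × ℝ, ‖q.1 - z‖^2 + s q.2 ≠ 0 := fun q => (hqpos q.1 q.2).ne'
    have hn2 : ∀ q : EuclideanSpace ℝ (Fin N) × ℝ, (‖q.1 - z‖^2 + s q.2)^2 ≠ 0 := fun q => pow_ne_zero _ (hn1 q)
    have hn3 : ∀ q : EuclideanSpace ℝ (Fin N) × ℝ, s q.2 ≠ 0 := fun q => (hspos q.2).ne'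
    have d1 : Continuous (fun q : EuclideanSpace ℝ (Fin N) × ℝ => 4096 * q.2 / s q.2 / (‖q.1 - z‖^2 + s q.2)) :=
      (Continuous.div (by fun_prop) (by fun_prop) hn3).div hcq hn1
    have d2 : Continuous (fun q : EuclideanSpace ℝ (Fin N) × ℝ => 4 * ‖q.1 - z‖^2 / (‖q.1 - z‖^2 + s q.2)^2) :=
      Continuous.div (by fun_prop) (by fun_prop) hn2
    have d3 : Continuous (fun q : EuclideanSpace ℝ (Fin N) × ℝ => 2 * (N:ℝ) / (‖q.1 - z‖^2 + s q.2)) :=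
      Continuous.div (by fun_prop) (by fun_prop) hn1
    exact (c1.mul d1).neg.sub ((c2.mul d2).add (c1.mul (d3.sub d2)))
  · intro x t
    rw [hdt, hlap]
    have hq := hqpos x t
    have hr2 : 0 ≤ ‖x - z‖^2 := by positivity
    have hst := hspos t
    have hsgt := hsge t
    change _ ≤ η x t ^ N * (M * (36 + N) / L / (‖x - z‖^2 + s t))
    have hrq : ‖x - z‖^2 ≤ ‖x - z‖^2 + s t := by linarith
    have hb1 : |deriv Φ (Real.log (‖x - z‖^2 + s t))| ≤ M * η x t ^ N / (2 * L) := by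
      rw [hΦ1]
      simp only [abs_mul, abs_neg]
      rw [abs_of_pos (a := 1 / (2 * L)) (by positivity), mul_one_div]
      gcongr
      exact (hb _).1
    have hb2 : |deriv (deriv Φ) (Real.log (‖x - z‖^2 + s t))| ≤ M * η x t ^ N / (2 * L) := by
      rw [hΦ2]
      simp only [abs_mul, abs_neg]
      rw [abs_of_pos (a := 1 / (2 * L)) (by positivity), mul_one_div]
      have h1 : |deriv (deriv P) (A (Real.log (‖x - z‖^2 + s t)))| / (2*L) ≤ M * η x t ^ N / (2 * L) := by
        gcongr
        exact (hb _).2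
      have h2 : 1 / (2*L) ≤ 1 := by
        rw [div_le_one (by positivity)]; linarith
      refine le_trans ?_ h1
      gcongr
      exact mul_le_of_le_one_right (by positivity) h2
    generalize deriv (deriv Φ) (Real.log (‖x - z‖^2 + s t)) = D2 at *
    generalize deriv Φ (Real.log (‖x - z‖^2 + s t)) = D1 at *
    generalize hE : M * η x t ^ N / (2 * L) = E at *
    generalize hqq : ‖x - z‖^2 + s t = q at *
    generalize ‖x - z‖^2 = r at *
    have e1 : |4096 * t / s t / q| ≤ 64 / q := by
      rw [abs_div, abs_of_pos hq, abs_div, abs_of_pos hst, abs_mul, abs_of_pos (by norm_num : (0:ℝ) < 4096)]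
      gcongr
      rw [div_le_iff₀ hst]; linarith
    have e2' : 4 * r / q^2 ≤ 4 / q := by
      rw [div_le_div_iff₀ (by positivity) hq]; nlinarith
    have e2 : |4 * r / q^2| ≤ 4 / q := by
      rw [abs_of_nonneg (by positivity)]; exact e2'
    have e3 : |2 * N / q - 4 * r / q^2| ≤ (2 * N + 4) / q := by
      refine (abs_sub _ _).trans ?_
      rw [abs_of_nonneg (a := 2 * (N:ℝ) / q) (by positivity), add_div]
      linarith
    have hE0 : 0 ≤ E := (abs_nonneg _).trans hb1
    calc _ ≤ |D1| * |4096 * t / s t / q| + (|D2| * |4 * r / q^2| + |D1| * |2 * N / q - 4 * r / q^2|) := by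
          rw [← abs_mul, ← abs_mul, ← abs_mul]
          refine (abs_sub _ _).trans ?_
          rw [abs_neg]
          gcongr
          exact abs_add_le _ _
      _ ≤ E * (64 / q) + (E * (4 / q) + E * ((2 * N + 4) / q)) := by gcongr
      _ = _ := by
          rw [← hE]; field_simp; ring
  · refine ⟨Metric.closedBall z (Real.sqrt (32 * T)), isCompact_closedBall _ _, fun x hx t => hη0 x t ?_⟩
    simp only [Metric.mem_closedBall, not_le, dist_eq_norm] at hx
    have := (Real.sqrt_lt' (lt_of_le_of_lt (Real.sqrt_nonneg _) hx)).1 hx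
    linarith [hspos t]

lemma time_int (T σ L : ℝ) (hT : 0 < T) (hσ : 0 < σ) (hσT : σ^2 < T) (hLdef : L = Real.log (16 * T / σ^2) / 2) :
    IntegrableOn (fun t => (t + σ^2)⁻¹) (Ioo 0 (T/2)) ∧ ∫ t in Ioo 0 (T/2), (t + σ^2)⁻¹ ≤ 2 * L := by
  have hσ2 : 0 < σ^2 := by positivity
  have hc : ContinuousOn (fun t => (t + σ^2)⁻¹) (Icc 0 (T/2)) := by
    apply ContinuousOn.inv₀ (by fun_prop)
    intro t ht
    have := ht.1
    positivity
  constructor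
  · exact (hc.integrableOn_compact isCompact_Icc).mono_set Ioo_subset_Icc_self
  · rw [← integral_Ioc_eq_integral_Ioo, ← intervalIntegral.integral_of_le (by positivity),
      intervalIntegral.integral_comp_add_right (fun t => t⁻¹), integral_inv_of_pos (by positivity) (by positivity)]
    rw [hLdef, mul_div_cancel₀ _ two_ne_zero]
    apply Real.log_le_log (by positivity)
    rw [zero_add]
    gcongr
    linarith

/-- Necessary condition on the initial data for the existence of a very weak supersolution
of the semilinear heat equation `∂_t u - Δu = u^p`, in the critical case `p = 1 + 2/N`. -/
theorem stmt_3 (N : ℕ) (hN : 1 ≤ N) (p : ℝ) (hpF : p = 1 + 2 / N) :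
    ∃ γ : ℝ, 0 < γ ∧ ∀ T : ℝ, 0 < T →
      ∀ μ : Measure (EuclideanSpace ℝ (Fin N)), IsFiniteMeasureOnCompacts μ →
      (∃ u, IsVeryWeakSupersolutionHeat N p T μ u) →
      ∀ z : EuclideanSpace ℝ (Fin N), ∀ σ : ℝ, 0 < σ → σ < T ^ ((1:ℝ)/2) →
        μ (Metric.ball z σ) ≤
          ENNReal.ofReal (γ * (Real.log (Real.exp 1 + T ^ ((1:ℝ)/2) / σ)) ^ (-(N:ℝ)/2)) := by
  obtain ⟨M0, hM0, htest⟩ := test_fun N hN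
  obtain ⟨C, hC, hker⟩ := int_kernel N
  have hN0 : (0:ℝ) < N := by exact_mod_cast hN
  set r : ℝ := 1 + (N:ℝ)/2 with hr
  have hr0 : 0 < r := by positivity
  have hp1 : 1 < p := by rw [hpF]; have : 0 < 2 / (N:ℝ) := by positivity
                         linarith
  have hconj : p.HolderConjugate r := by
    rw [Real.holderConjugate_iff]
    refine ⟨hp1, ?_⟩
    rw [hpF, hr]
    field_simp
    ring
  refine ⟨4 * C * M0 ^ r, by positivity, ?_⟩
  rintro T hT μ hμ ⟨u, hum, hu0, hui, hsup⟩ z σ hσ hσT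
  rw [← Real.sqrt_eq_rpow] at hσT ⊢
  have hR : 0 < Real.sqrt T := Real.sqrt_pos.2 hT
  have hRR : Real.sqrt T ^ 2 = T := Real.sq_sqrt hT.le
  have hσ2T : σ^2 < T := by rw [← hRR]; gcongr
  obtain ⟨L, hLdef⟩ : ∃ L, L = Real.log (16 * T / σ^2) / 2 := ⟨_, rfl⟩
  have hL4 : L = Real.log (4 * Real.sqrt T / σ) := by
    rw [hLdef, show 16 * T / σ^2 = (4 * Real.sqrt T / σ)^2 by
      rw [div_pow, mul_pow, hRR]; norm_num, Real.log_pow]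
    push_cast; ring
  have he := Real.exp_one_lt_d9
  have hratio : 1 < Real.sqrt T / σ := by rwa [one_lt_div hσ]
  have harg : Real.exp 1 + Real.sqrt T / σ ≤ 4 * Real.sqrt T / σ := by
    rw [mul_div_assoc]; linarith
  have hlogL : Real.log (Real.exp 1 + Real.sqrt T / σ) ≤ L := by
    rw [hL4]; exact Real.log_le_log (by positivity) harg
  have hlog1 : 1 ≤ Real.log (Real.exp 1 + Real.sqrt T / σ) := by
    rw [Real.le_log_iff_exp_le (by positivity)]
    linarith
  have hL1 : 1 ≤ L := hlog1.trans hlogL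
  have hL0 : 0 < L := by linarith
  obtain ⟨φ, η, hφs, hφc, hφT, hφ1, hη, hφη, hGc, hGb, K, hK, hηK⟩ := htest T σ L z hT hσ hLdef hL1
  have hτ : T/2 ∈ Ioo (0:ℝ) T := ⟨by linarith, by linarith⟩
  have hφ0 : ∀ x t, 0 ≤ φ x t := fun x t => by rw [hφη]; exact pow_nonneg (hη x t).1 _
  have hS := hsup (T/2) hτ φ hφs hφc hφ0 hφT
  obtain ⟨hiu, hiup⟩ := hui K hK (T/2) hτ
  obtain ⟨hti, htb⟩ := time_int T σ L hT hσ hσ2T hLdef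
  -- lower bound of the initial term
  have hcont0 : Continuous (fun x => φ x 0) := hφs.continuous.comp (by fun_prop : Continuous fun x : EuclideanSpace ℝ (Fin N) => (x, (0:ℝ)))
  have hφ00 : Integrable (fun x => φ x 0) μ := by
    apply hcont0.integrable_of_hasCompactSupport
    refine HasCompactSupport.intro hK fun x hx => ?_
    rw [hφη, hηK x hx]; simp
  have hmu : μ.real (Metric.ball z σ) ≤ ∫ x, φ x 0 ∂μ := by
    rw [← integral_indicator_one Metric.isOpen_ball.measurableSet]
    apply integral_mono_of_nonneg
    · exact Filter.Eventually.of_forall fun x => indicator_nonneg (fun _ _ => zero_le_one) x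
    · exact hφ00
    · refine Filter.Eventually.of_forall fun x => ?_
      by_cases hx : x ∈ Metric.ball z σ
      · simp [indicator_of_mem hx, hφ1 x hx]
      · simp [indicator_of_notMem hx, hφ0]
  have hmeasIoo : MeasurableSet ((univ : Set (EuclideanSpace ℝ (Fin N))) ×ˢ Ioo (0:ℝ) (T/2)) :=
    MeasurableSet.univ.prod measurableSet_Ioo
  have hrestr : (volume : Measure (EuclideanSpace ℝ (Fin N) × ℝ)).restrict (univ ×ˢ Ioo (0:ℝ) (T/2))
      = (volume : Measure (EuclideanSpace ℝ (Fin N))).prod (volume.restrict (Ioo (0:ℝ) (T/2))) := by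
    rw [Measure.volume_eq_prod, ← Measure.prod_restrict, Measure.restrict_univ]
  have hGnn : ∀ x t, (0:ℝ) < ‖x - z‖^2 + Real.sqrt (4096 * t^2 + σ^4) := fun x t => by
    have : 0 < Real.sqrt (4096 * t^2 + σ^4) := Real.sqrt_pos.2 (by positivity)
    positivity
  have hsσ : ∀ t : ℝ, σ^2 ≤ Real.sqrt (4096 * t^2 + σ^4) := fun t => by
    apply Real.le_sqrt_of_sq_le; nlinarith [sq_nonneg t]
  have hIG : Integrable (fun q : EuclideanSpace ℝ (Fin N) × ℝ => u q.1 q.2 *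
      (-(deriv (φ q.1) q.2) - euclLap N (fun y => φ y q.2) q.1))
      ((volume : Measure (EuclideanSpace ℝ (Fin N))).prod (volume.restrict (Ioo (0:ℝ) (T/2)))) := by
    rw [← hrestr]
    have h1 : IntegrableOn (fun q : EuclideanSpace ℝ (Fin N) × ℝ => u q.1 q.2 *
      (-(deriv (φ q.1) q.2) - euclLap N (fun y => φ y q.2) q.1)) (K ×ˢ Ioo (0:ℝ) (T/2)) := by
      refine Integrable.mul_bdd (c := M0 / L / σ^2) hiu hGc.aestronglyMeasurable ?_
      refine Filter.Eventually.of_forall fun q => ?_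
      rw [Real.norm_eq_abs]
      refine (hGb q.1 q.2).trans ?_
      refine (mul_le_of_le_one_left (by have := hGnn q.1 q.2; positivity) (pow_le_one₀ (hη _ _).1 (hη _ _).2)).trans ?_
      gcongr
      have := hsσ q.2
      nlinarith [sq_nonneg ‖q.1 - z‖]
    refine IntegrableOn.of_forall_diff_eq_zero h1 hmeasIoo ?_
    rintro ⟨x, t⟩ ⟨h2, h3⟩
    have hxK : x ∉ K := fun h => h3 ⟨h, h2.2⟩
    have h4 := hGb x t
    rw [hηK x hxK, zero_pow (by omega), zero_mul] at h4
    have h5 := abs_nonpos_iff.1 h4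
    simp only [h5, mul_zero]
  have hIU : Integrable (fun q : EuclideanSpace ℝ (Fin N) × ℝ => u q.1 q.2 ^ p * φ q.1 q.2)
      ((volume : Measure (EuclideanSpace ℝ (Fin N))).prod (volume.restrict (Ioo (0:ℝ) (T/2)))) := by
    rw [← hrestr]
    have h1 : IntegrableOn (fun q : EuclideanSpace ℝ (Fin N) × ℝ => u q.1 q.2 ^ p * φ q.1 q.2)
        (K ×ˢ Ioo (0:ℝ) (T/2)) := by
      refine Integrable.mul_bdd (c := 1) hiup hφs.continuous.aestronglyMeasurable ?_
      refine Filter.Eventually.of_forall fun q => ?_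
      change ‖φ q.1 q.2‖ ≤ 1
      rw [Real.norm_eq_abs, abs_of_nonneg (hφ0 _ _), hφη]
      exact pow_le_one₀ (hη _ _).1 (hη _ _).2
    refine IntegrableOn.of_forall_diff_eq_zero h1 hmeasIoo ?_
    rintro ⟨x, t⟩ ⟨h2, h3⟩
    have hxK : x ∉ K := fun h => h3 ⟨h, h2.2⟩
    simp [hφη, hηK x hxK]
  -- pointwise Young
  have hpt : ∀ x, ∀ t ∈ Ioo (0:ℝ) (T/2), u x t * (-(deriv (φ x) t) - euclLap N (fun y => φ y t) x) ≤
      u x t ^ p * φ x t + (M0 / L) ^ r * (‖x - z‖^2 + Real.sqrt (4096 * t^2 + σ^4)) ^ (-r) := by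
    intro x t ht
    have hu := hu0 x t ⟨ht.1, by linarith [ht.2]⟩
    have hq := hGnn x t
    have hηn : 0 ≤ η x t ^ N := pow_nonneg (hη x t).1 _
    have h1 := Real.young_inequality_of_nonneg (a := u x t * η x t ^ N)
      (b := M0 / L / (‖x - z‖^2 + Real.sqrt (4096 * t^2 + σ^4))) (by positivity) (by positivity) hconj
    have h2 : (u x t * η x t ^ N) ^ p = u x t ^ p * φ x t := by
      rw [Real.mul_rpow hu hηn, hφη, ← Real.rpow_natCast, ← Real.rpow_natCast, ← Real.rpow_mul (hη x t).1]
      congr 2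
      rw [hpF]; push_cast; field_simp
    have h3 : (M0 / L / (‖x - z‖^2 + Real.sqrt (4096 * t^2 + σ^4))) ^ r =
        (M0 / L) ^ r * (‖x - z‖^2 + Real.sqrt (4096 * t^2 + σ^4)) ^ (-r) := by
      rw [Real.div_rpow (by positivity) hq.le, Real.rpow_neg hq.le]; rfl
    rw [h2, h3] at h1
    have h4 : u x t ^ p * φ x t / p ≤ u x t ^ p * φ x t :=
      div_le_self (mul_nonneg (Real.rpow_nonneg hu _) (hφ0 _ _)) hp1.le
    have h5 : (M0 / L) ^ r * (‖x - z‖^2 + Real.sqrt (4096 * t^2 + σ^4)) ^ (-r) / r ≤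
        (M0 / L) ^ r * (‖x - z‖^2 + Real.sqrt (4096 * t^2 + σ^4)) ^ (-r) :=
      div_le_self (by positivity) (by rw [hr]; linarith)
    calc _ ≤ u x t * (η x t ^ N * (M0 / L / (‖x - z‖^2 + Real.sqrt (4096 * t^2 + σ^4)))) := by
          gcongr
          exact (le_abs_self _).trans (hGb x t)
      _ = u x t * η x t ^ N * (M0 / L / (‖x - z‖^2 + Real.sqrt (4096 * t^2 + σ^4))) := by ring
      _ ≤ _ := by linarith
  have hmain : (∫ t in Ioo (0:ℝ) (T/2), ∫ x, u x t * (-(deriv (φ x) t) - euclLap N (fun y => φ y t) x)) ≤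
      ∫ t in Ioo (0:ℝ) (T/2), ((∫ x, u x t ^ p * φ x t) + (M0 / L) ^ r * (2 * C) * (t + σ^2)⁻¹) := by
    have hi1 := hIG.integral_prod_right
    have hi2 := hIU.integral_prod_right
    refine integral_mono_ae hi1 (hi2.add (hti.const_mul _)) ?_
    filter_upwards [hIG.prod_left_ae, hIU.prod_left_ae, ae_restrict_mem measurableSet_Ioo] with t h1 h2 ht
    have hst : 0 < Real.sqrt (4096 * t^2 + σ^4) := Real.sqrt_pos.2 (by positivity)
    obtain ⟨hk1, hk2⟩ := hker z _ hst
    have h3 := integral_mono h1 (h2.add (hk1.const_mul ((M0 / L) ^ r))) (fun x => hpt x t ht)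
    refine h3.trans ?_
    simp only [Pi.add_apply]
    rw [integral_add h2 (hk1.const_mul _), integral_const_mul]
    have ht0 := ht.1
    have h4 : (t + σ^2) / 2 ≤ Real.sqrt (4096 * t^2 + σ^4) := by
      apply Real.le_sqrt_of_sq_le
      nlinarith [sq_nonneg (t - σ^2), sq_nonneg t, sq_nonneg (σ^2)]
    have h5 : C / Real.sqrt (4096 * t^2 + σ^4) ≤ 2 * C * (t + σ^2)⁻¹ := by
      calc _ ≤ C / ((t + σ^2) / 2) := by gcongr
        _ = _ := by field_simp
    rw [mul_assoc]
    gcongr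
    exact hk2.trans h5
  rw [integral_add hIU.integral_prod_right (hti.const_mul _), integral_const_mul] at hmain
  have hfin : μ.real (Metric.ball z σ) ≤ (M0 / L) ^ r * (2 * C) * (2 * L) := by
    have : (M0 / L) ^ r * (2 * C) * ∫ t in Ioo 0 (T/2), (t + σ^2)⁻¹ ≤ (M0 / L) ^ r * (2 * C) * (2 * L) := by
      gcongr
    linarith
  have heq : (M0 / L) ^ r * (2 * C) * (2 * L) = 4 * C * M0 ^ r * L ^ (-(N:ℝ)/2) := by
    rw [Real.div_rpow hM0.le hL0.le, hr, Real.rpow_add hL0, Real.rpow_one, neg_div, Real.rpow_neg hL0.le]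
    have : 0 < L ^ ((N:ℝ)/2) := by positivity
    field_simp
    ring
  have hlast : L ^ (-(N:ℝ)/2) ≤ (Real.log (Real.exp 1 + Real.sqrt T / σ)) ^ (-(N:ℝ)/2) :=
    Real.rpow_le_rpow_of_nonpos (by linarith) hlogL (by rw [neg_div]; linarith [half_pos hN0])
  have hball : μ (Metric.ball z σ) ≠ ⊤ := measure_ball_lt_top.ne
  rw [← ENNReal.ofReal_toReal hball]
  apply ENNReal.ofReal_le_ofReal
  change μ.real _ ≤ _
  rw [heq] at hfin
  refine hfin.trans ?_
  gcongr
end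

section
/- Let N ≥ 1 be an integer, θ ∈ (0,2), p > 1, and T ∈ (0,∞). There exists a constant C > 0 depending only on N, θ, and p such that: if μ is a nonnegative Radon measure on ℝ^N and there exists a very weak supersolution u of ∂_t u + (−Δ)^{θ/2} u = u^p with initial data μ on ℝ^N × [0,T), then for every τ ∈ (0,T) and every nonnegative smooth compactly supported φ : ℝ^N × [0,τ] → ℝ with φ(·,τ) = 0, one has ∫_{ℝ^N} φ(x,0)^{p/(p−1)} dμ(x) ≤ C ∫∫_{supp φ} |(−∂_t φ(x,t) + (−Δ)^{θ/2}φ(·,t)(x))|^{p/(p−1)} dx dt, where the right-hand integral is taken over the support of φ. -/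
open MeasureTheory Real Set

noncomputable def FF (m : ℕ) (q ε s : ℝ) : ℝ := s ^ m * (s + ε) ^ (q - m)
noncomputable def FF' (m : ℕ) (q ε s : ℝ) : ℝ :=
  m * s ^ (m-1) * (s + ε) ^ (q - m) + s ^ m * ((q - m) * (s + ε) ^ (q - m - 1))

lemma FF_nonneg (m : ℕ) (q ε s : ℝ) (hε : 0 < ε) (hs : 0 ≤ s) : 0 ≤ FF m q ε s := by
  unfold FF; positivity

lemma FF_hasDeriv (m : ℕ) (q ε s : ℝ) (hε : 0 < ε) (hs : 0 ≤ s) :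
    HasDerivAt (FF m q ε) (FF' m q ε s) s := by
  unfold FF FF'
  have h1 := hasDerivAt_pow m s
  have h2 : HasDerivAt (fun s : ℝ => (s + ε) ^ (q - m)) (1 * (q - m) * (s + ε) ^ (q - m - 1)) s :=
    ((hasDerivAt_id s).add_const ε).rpow_const (Or.inl (by simp; positivity))
  refine (h1.mul h2).congr_deriv ?_
  ring

lemma FF_tangent (m : ℕ) (q ε : ℝ) (hq : 1 < q) (hm : q ≤ m) (hε : 0 < ε)
    (a b : ℝ) (ha : 0 ≤ a) (hb : 0 ≤ b) :
    FF m q ε a - FF m q ε b ≤ FF' m q ε a * (a - b) := by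
  have hm1 : 2 ≤ m := by
    have : (1:ℝ) < m := by linarith
    exact_mod_cast this
  rcases eq_or_lt_of_le ha with h0 | ha
  · subst h0
    have e1 : (0:ℝ) ^ m = 0 := zero_pow (by omega)
    have e2 : (0:ℝ) ^ (m-1) = 0 := zero_pow (by omega)
    have := FF_nonneg m q ε b hε hb
    have e3 : FF m q ε 0 = 0 := by simp [FF, e1]
    have e4 : FF' m q ε 0 = 0 := by simp [FF', e1, e2]
    rw [e3, e4]; linarith
  obtain ⟨k, hk⟩ : ∃ k : ℝ, k = m - q := ⟨_, rfl⟩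
  have hk0 : 0 ≤ k := by linarith
  have hmp : (0:ℝ) < m := by linarith
  set c := a + ε with hc
  have hcp : 0 < c := by positivity
  set X := b / a
  set Y := (b + ε) / c
  have hX : 0 ≤ X := by positivity
  have hY : 0 < Y := by positivity
  -- key AM-GM
  have key : m * X ≤ X ^ m * Y ^ (-k) + k * Y + (m - 1 - k) := by
    have h := Real.geom_mean_le_arith_mean3_weighted (w₁ := 1 / m) (w₂ := k / m)
      (w₃ := (m - 1 - k) / m) (p₁ := X ^ m * Y ^ (-k)) (p₂ := Y) (p₃ := 1)
      (by positivity) (by positivity) (div_nonneg (by linarith) hmp.le) (by positivity) hY.le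
      zero_le_one (by field_simp; ring)
    have e : (X ^ m * Y ^ (-k)) ^ (1 / (m:ℝ)) * Y ^ (k / m) * (1:ℝ) ^ ((m - 1 - k) / (m:ℝ)) = X := by
      rw [Real.one_rpow, mul_one, Real.mul_rpow (by positivity) (by positivity),
        ← Real.rpow_mul hY.le, mul_assoc, ← Real.rpow_add hY, one_div,
        Real.pow_rpow_inv_natCast hX (by omega)]
      have : -k * (m:ℝ)⁻¹ + k / m = 0 := by field_simp; ring
      rw [this]; simp
    rw [e] at h
    have := mul_le_mul_of_nonneg_left h hmp.le
    have e2 : (m:ℝ) * (1 / m * (X ^ m * Y ^ (-k)) + k / m * Y + (m - 1 - k) / m * 1) =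
      X ^ m * Y ^ (-k) + k * Y + (m - 1 - k) := by field_simp
    linarith
  have hqk : q - m = -k := by linarith
  set P := a ^ m * c ^ (-k) with hP
  have hPp : 0 < P := by positivity
  have eb : FF m q ε b = P * (X ^ m * Y ^ (-k)) := by
    unfold FF
    rw [hqk, hP]
    have e1 : b = a * X := by simp only [X]; field_simp
    have e2 : b + ε = c * Y := by simp only [Y]; field_simp
    rw [e2]; rw [Real.mul_rpow hcp.le hY.le]
    conv_lhs => rw [e1]
    rw [mul_pow]; ring
  have ea : FF m q ε a = P := by unfold FF; rw [hqk]
  have ea' : FF' m q ε a = P * (m / a - k / c) := by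
    unfold FF'
    rw [hqk, hP, ← hc, Real.rpow_sub_one hcp.ne']
    have : a ^ m = a ^ (m-1) * a := by rw [← pow_succ]; congr 1; omega
    rw [this]; field_simp; ring
  rw [ea, eb, ea']
  have e5 : P * (m / a - k / c) * (a - b) = P * (m - m * X - k + k * Y) := by
    simp only [X, Y]
    have : a - b = c - (b + ε) := by rw [hc]; ring
    have e6 : (m / a - k / c) * (a - b) = m / a * (a - b) - k / c * (c - (b + ε)) := by
      rw [← this]; ring
    rw [mul_assoc, e6]; field_simp; ring
  rw [e5]
  have := mul_le_mul_of_nonneg_left key hPp.le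
  nlinarith

lemma FF_young (m : ℕ) (p q ε : ℝ) (hpq : p.HolderConjugate q) (hm : q ≤ m) (hε : 0 < ε)
    (s u g : ℝ) (hs : 0 < s) (hu : 0 ≤ u) :
    u * (FF' m q ε s * g) ≤ u ^ p * FF m q ε s + (m:ℝ) ^ q * |g| ^ q := by
  have hq := hpq.symm.lt
  have hm0 : (0:ℝ) < m := by linarith [hpq.symm.pos]
  have hm1 : 1 ≤ m := by exact_mod_cast hm0
  have hc : 0 < s + ε := by positivity
  have hp0 := hpq.pos
  have hq0 := hpq.symm.pos
  -- FF' ≤ G and FF' ≥ 0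
  set G := m * s ^ (m-1) * (s + ε) ^ (q - m) with hG
  have hGp : 0 < G := by positivity
  have es : s ^ m = s ^ (m-1) * s := by rw [← pow_succ]; congr 1; omega
  have h1 : FF' m q ε s ≤ G := by
    unfold FF'
    have : s ^ m * ((q - m) * (s + ε) ^ (q - m - 1)) ≤ 0 :=
      mul_nonpos_of_nonneg_of_nonpos (by positivity)
        (mul_nonpos_of_nonpos_of_nonneg (by linarith) (by positivity))
    linarith
  have h2 : 0 ≤ FF' m q ε s := by
    unfold FF'
    rw [Real.rpow_sub_one hc.ne', es]
    have : m * s ^ (m - 1) * (s + ε) ^ (q - m) + s ^ (m - 1) * s * ((q - m) * ((s + ε) ^ (q - m) / (s + ε)))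
      = s ^ (m-1) * (s + ε) ^ (q - m) * ((m * ε + q * s) / (s + ε)) := by field_simp; ring
    rw [this]; positivity
  set P := FF m q ε s with hP
  have hPp : 0 < P := by rw [hP]; unfold FF; positivity
  have y := Real.young_inequality_of_nonneg (a := u * P ^ (1/p)) (b := G * P ^ (-(1/p)) * |g|)
    (by positivity) (by positivity) hpq
  have e0 : u * P ^ (1/p) * (G * P ^ (-(1/p)) * |g|) = u * (G * |g|) := by
    rw [Real.rpow_neg hPp.le]; field_simp
  have e1 : (u * P ^ (1/p)) ^ p = u ^ p * P := by
    rw [Real.mul_rpow hu (by positivity), ← Real.rpow_mul hPp.le, one_div_mul_cancel hp0.ne', Real.rpow_one]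
  have e2 : (G * P ^ (-(1/p)) * |g|) ^ q ≤ (m:ℝ) ^ q * |g| ^ q := by
    rw [Real.mul_rpow (by positivity) (by positivity)]
    gcongr
    have hk : G ≤ m * P ^ (1/p) := by
      -- s^(m-1) c^(q-m) ≤ (s^m c^(q-m))^(1/p)
      have hq1 : 1/p = 1 - 1/q := by
        have := hpq.inv_add_inv_eq_one
        rw [one_div, one_div]; linarith
      have hPr : P = s ^ (m:ℝ) * (s + ε) ^ (q - m) := by rw [hP]; unfold FF; rw [Real.rpow_natCast]
      have : P ^ (1/p) = P * P ^ (-(1/q)) := by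
        rw [hq1, sub_eq_add_neg, Real.rpow_add hPp, Real.rpow_one]
      have hb : P ≤ s ^ q := by
        have e : s ^ q = s ^ (m:ℝ) * s ^ (q - m) := by rw [← Real.rpow_add hs]; congr 1; ring
        rw [hPr, e]
        gcongr ?_ * ?_
        exact Real.rpow_le_rpow_of_nonpos hs (by linarith) (by linarith)
      have hb2 : s⁻¹ ≤ P ^ (-(1/q)) := by
        calc s⁻¹ = (s ^ q) ^ (-(1/q)) := by
              rw [← Real.rpow_mul hs.le, mul_neg, mul_one_div_cancel hq0.ne', Real.rpow_neg_one]
          _ ≤ _ := Real.rpow_le_rpow_of_nonpos hPp hb (by simp; positivity)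
      have hGP : G = m * (P * s⁻¹) := by
        rw [hG, hP]; unfold FF; rw [es]; field_simp
      rw [hGP, this]
      gcongr
    rw [Real.rpow_neg hPp.le]
    rw [← div_eq_mul_inv, div_le_iff₀ (by positivity)]; exact hk
  rw [e0, e1] at y
  have hp1 := hpq.lt
  calc u * (FF' m q ε s * g) ≤ u * (G * |g|) := by
        refine mul_le_mul_of_nonneg_left ?_ hu
        exact (mul_le_mul_of_nonneg_left (le_abs_self g) h2).trans (mul_le_mul_of_nonneg_right h1 (abs_nonneg g))
    _ ≤ _ := y
    _ ≤ u ^ p * P + (m:ℝ) ^ q * |g| ^ q := by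
        have a1 : 0 ≤ u ^ p * P := by positivity
        have a2 : 0 ≤ (m:ℝ) ^ q * |g| ^ q := by positivity
        have b1 := div_le_self a1 hp1.le
        have b2 := div_le_self a2 hq.le
        have b3 : (G * P ^ (-(1/p)) * |g|) ^ q / q ≤ (m:ℝ) ^ q * |g| ^ q / q := by gcongr
        linarith

lemma kernel_integrable (N : ℕ) (hN : 1 ≤ N) (θ : ℝ) (hθ : θ ∈ Set.Ioo (0:ℝ) 2) :
    Integrable (fun z : EuclideanSpace ℝ (Fin N) =>
      min 1 (‖z‖ ^ 2) * ‖z‖ ^ (-(N : ℝ) - θ)) := by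
  have : Nonempty (Fin N) := ⟨⟨0, hN⟩⟩
  have : Nontrivial (EuclideanSpace ℝ (Fin N)) := inferInstance
  rw [integrable_fun_norm_addHaar (μ := (volume : Measure (EuclideanSpace ℝ (Fin N))))
    (f := fun r : ℝ => min 1 (r ^ 2) * r ^ (-(N : ℝ) - θ))]
  rw [finrank_euclideanSpace_fin]
  have hcast : ((N - 1 : ℕ) : ℝ) = N - 1 := by push_cast [hN]; ring
  rw [← Ioc_union_Ioi_eq_Ioi (zero_le_one (α := ℝ))]
  apply IntegrableOn.union
  · rw [integrableOn_Ioc_iff_integrableOn_Ioo]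
    have := (intervalIntegral.integrableOn_Ioo_rpow_iff (s := 1 - θ) zero_lt_one).2 (by linarith [hθ.2])
    refine this.congr_fun (fun r hr => ?_) measurableSet_Ioo
    have hr0 := hr.1
    have h1 : r ^ 2 ≤ 1 := pow_le_one₀ hr.1.le hr.2.le
    simp only [smul_eq_mul]
    rw [min_eq_right h1, ← Real.rpow_natCast, ← Real.rpow_natCast, ← Real.rpow_add hr0,
      ← Real.rpow_add hr0, hcast]
    congr 1; push_cast; ring
  · have := integrableOn_Ioi_rpow_of_lt (a := -1 - θ) (by linarith [hθ.1]) zero_lt_one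
    refine this.congr_fun (fun r hr => ?_) measurableSet_Ioi
    have hr1 : 1 < r := hr
    have hr0 : 0 < r := by linarith
    have h1 : 1 ≤ r ^ 2 := one_le_pow₀ hr1.le
    simp only [smul_eq_mul]
    rw [min_eq_left h1, one_mul, ← Real.rpow_natCast, ← Real.rpow_add hr0, hcast]
    congr 1; ring

lemma second_diff_bound {V : Type*} [NormedAddCommGroup V] [NormedSpace ℝ V] (Φ : V → ℝ)
    (h1 : ContDiff ℝ (⊤ : ℕ∞) Φ) (h2 : HasCompactSupport Φ) :
    ∃ K : ℝ, 0 ≤ K ∧ ∀ w v : V, |2 * Φ w - Φ (w + v) - Φ (w - v)| ≤ K * min 1 (‖v‖ ^ 2) := by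
  obtain ⟨M, hM⟩ := h2.exists_bound_of_continuous h1.continuous
  have hd : ContDiff ℝ 1 (fderiv ℝ Φ) := h1.fderiv_right (by norm_cast)
  obtain ⟨L, hL⟩ := hd.lipschitzWith_of_hasCompactSupport (h2.fderiv ℝ) one_ne_zero
  have hM0 : 0 ≤ M := (norm_nonneg _).trans (hM 0)
  refine ⟨max (4 * M) (2 * L), by positivity, fun w v => ?_⟩
  rw [mul_min_of_nonneg _ _ (by positivity : (0:ℝ) ≤ max (4 * M) (2 * L)), mul_one]
  apply le_min
  · refine le_trans ?_ (le_max_left _ _)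
    have a1 := abs_le.1 (hM w)
    have a2 := abs_le.1 (hM (w + v))
    have a3 := abs_le.1 (hM (w - v))
    rw [abs_le]; constructor <;> linarith [a1.1, a1.2, a2.1, a2.2, a3.1, a3.2]
  · have hdiff : Differentiable ℝ Φ := h1.differentiable (by simp)
    have key := Convex.norm_image_sub_le_of_norm_hasFDerivWithin_le (𝕜 := ℝ)
      (f := fun y => Φ (w + y) + Φ (w - y))
      (f' := fun y => fderiv ℝ Φ (w + y) - fderiv ℝ Φ (w - y))
      (s := Metric.closedBall (0:V) ‖v‖) (C := L * (2 * ‖v‖)) (x := 0) (y := v) ?_ ?_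
      (convex_closedBall _ _) (by simp) (by simp)
    · simp only [add_zero, sub_zero, Real.norm_eq_abs] at key
      rw [show 2 * Φ w - Φ (w + v) - Φ (w - v) = -(Φ (w + v) + Φ (w - v) - (Φ w + Φ w)) by ring,
        abs_neg]
      refine key.trans ?_
      calc L * (2 * ‖v‖) * ‖v‖ = (2 * L) * ‖v‖ ^ 2 := by ring
        _ ≤ _ := by gcongr; exact le_max_right _ _
    · intro y _
      apply HasFDerivAt.hasFDerivWithinAt
      have e1 : HasFDerivAt (fun y => Φ (w + y)) (fderiv ℝ Φ (w + y)) y := by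
        rw [hasFDerivAt_comp_add_left]; exact (hdiff _).hasFDerivAt
      have e2 : HasFDerivAt (fun y => Φ (w - y)) (-fderiv ℝ Φ (w - y)) y := by
        have := (hdiff (w - y)).hasFDerivAt.comp y ((hasFDerivAt_id y).const_sub w)
        refine this.congr_fderiv ?_
        ext; simp
      have := e1.add e2
      rw [← sub_eq_add_neg] at this
      exact this
    · intro y hy
      have hy' : ‖y‖ ≤ ‖v‖ := by simpa using hy
      have := hL.norm_sub_le (w + y) (w - y)
      refine this.trans ?_
      gcongr
      rw [show w + y - (w - y) = y + y by abel]
      exact (norm_add_le _ _).trans (by linarith)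

lemma fl_bound (N : ℕ) (φ : EuclideanSpace ℝ (Fin N) → ℝ → ℝ)
    (h1 : ContDiff ℝ (⊤ : ℕ∞) (Function.uncurry φ))
    (h2 : HasCompactSupport (Function.uncurry φ)) :
    ∃ K : ℝ, 0 ≤ K ∧ ∀ (t : ℝ) (x z : EuclideanSpace ℝ (Fin N)),
      |2 * φ x t - φ (x + z) t - φ (x - z) t| ≤ K * min 1 (‖z‖ ^ 2) := by
  obtain ⟨K, hK, h⟩ := second_diff_bound _ h1 h2
  refine ⟨K, hK, fun t x z => ?_⟩
  have := h (x, t) (z, 0)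
  simpa [Function.uncurry, Prod.norm_def] using this

lemma fl_integrable (N : ℕ) (hN : 1 ≤ N) (θ : ℝ) (hθ : θ ∈ Set.Ioo (0:ℝ) 2)
    (φ : EuclideanSpace ℝ (Fin N) → ℝ → ℝ)
    (h1 : ContDiff ℝ (⊤ : ℕ∞) (Function.uncurry φ))
    (h2 : HasCompactSupport (Function.uncurry φ)) (x : EuclideanSpace ℝ (Fin N)) (t : ℝ) :
    Integrable (fun z : EuclideanSpace ℝ (Fin N) =>
      (2 * φ x t - φ (x + z) t - φ (x - z) t) * ‖z‖ ^ (-(N : ℝ) - θ)) := by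
  obtain ⟨K, hK, h⟩ := fl_bound N φ h1 h2
  refine ((kernel_integrable N hN θ hθ).const_mul K).mono' ?_ ?_
  · have hc : Continuous (Function.uncurry φ) := h1.continuous
    have c1 : Continuous fun z => φ (x + z) t := hc.comp (f := fun z => (x + z, t)) (by fun_prop)
    have c2 : Continuous fun z => φ (x - z) t := hc.comp (f := fun z => (x - z, t)) (by fun_prop)
    have c3 : Measurable fun z => φ (x + z) t := c1.measurable
    have c4 : Measurable fun z => φ (x - z) t := c2.measurable
    exact Measurable.aestronglyMeasurable (by fun_prop)
  · refine Filter.Eventually.of_forall fun z => ?_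
    rw [norm_mul, Real.norm_eq_abs, Real.norm_of_nonneg (by positivity), ← mul_assoc]
    gcongr
    exact h t x z

lemma const_nonneg (N : ℕ) (θ : ℝ) (hθ : θ ∈ Set.Ioo (0:ℝ) 2) :
    0 ≤ (Real.Gamma ((N + θ) / 2) / (Real.pi ^ ((N : ℝ) / 2) * Real.Gamma (2 - θ / 2))
      * (θ / 2) * (1 - θ / 2)) / 2 := by
  have h1 := hθ.1
  have h2 := hθ.2
  have := Real.Gamma_pos_of_pos (s := (N + θ) / 2) (by positivity)
  have := Real.Gamma_pos_of_pos (s := 2 - θ / 2) (by linarith)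
  have : 0 ≤ 1 - θ / 2 := by linarith
  positivity

lemma fracLap_comp_le (N : ℕ) (hN : 1 ≤ N) (θ : ℝ) (hθ : θ ∈ Set.Ioo (0:ℝ) 2)
    (φ ψ : EuclideanSpace ℝ (Fin N) → ℝ → ℝ)
    (h1 : ContDiff ℝ (⊤ : ℕ∞) (Function.uncurry φ))
    (h2 : HasCompactSupport (Function.uncurry φ))
    (h1' : ContDiff ℝ (⊤ : ℕ∞) (Function.uncurry ψ))
    (h2' : HasCompactSupport (Function.uncurry ψ)) (x : EuclideanSpace ℝ (Fin N)) (t d : ℝ)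
    (H : ∀ y, ψ x t - ψ y t ≤ d * (φ x t - φ y t)) :
    fracLap N θ (fun y => ψ y t) x ≤ d * fracLap N θ (fun y => φ y t) x := by
  unfold fracLap
  rw [mul_left_comm]
  refine mul_le_mul_of_nonneg_left ?_ (const_nonneg N θ hθ)
  rw [← integral_const_mul]
  refine integral_mono (fl_integrable N hN θ hθ ψ h1' h2' x t)
    ((fl_integrable N hN θ hθ φ h1 h2 x t).const_mul d) fun z => ?_
  simp only
  rw [← mul_assoc]
  refine mul_le_mul_of_nonneg_right ?_ (by positivity)
  linarith [H (x + z), H (x - z)]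

lemma g_meas (N : ℕ) (θ : ℝ)
    (φ : EuclideanSpace ℝ (Fin N) → ℝ → ℝ)
    (h1 : ContDiff ℝ (⊤ : ℕ∞) (Function.uncurry φ)) :
    Measurable (fun q : EuclideanSpace ℝ (Fin N) × ℝ =>
      -(deriv (φ q.1) q.2) + fracLap N θ (fun y => φ y q.2) q.1) := by
  have hc : Continuous (Function.uncurry φ) := h1.continuous
  apply Measurable.add
  · exact (measurable_deriv_with_param hc).neg
  · unfold fracLap
    apply Measurable.const_mul
    refine (StronglyMeasurable.integral_prod_right
      (f := fun (q : EuclideanSpace ℝ (Fin N) × ℝ) (z : EuclideanSpace ℝ (Fin N)) =>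
      (2 * φ q.1 q.2 - φ (q.1 + z) q.2 - φ (q.1 - z) q.2) * ‖z‖ ^ (-(N : ℝ) - θ)) ?_).measurable
    apply Measurable.stronglyMeasurable
    have c0 : Measurable fun r : (EuclideanSpace ℝ (Fin N) × ℝ) × EuclideanSpace ℝ (Fin N) =>
        φ r.1.1 r.1.2 := (hc.comp (f := fun r : (EuclideanSpace ℝ (Fin N) × ℝ) × EuclideanSpace ℝ (Fin N) => (r.1.1, r.1.2)) (by fun_prop)).measurable
    have c1 : Measurable fun r : (EuclideanSpace ℝ (Fin N) × ℝ) × EuclideanSpace ℝ (Fin N) =>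
        φ (r.1.1 + r.2) r.1.2 := (hc.comp (f := fun r : (EuclideanSpace ℝ (Fin N) × ℝ) × EuclideanSpace ℝ (Fin N) => (r.1.1 + r.2, r.1.2)) (by fun_prop)).measurable
    have c2 : Measurable fun r : (EuclideanSpace ℝ (Fin N) × ℝ) × EuclideanSpace ℝ (Fin N) =>
        φ (r.1.1 - r.2) r.1.2 := (hc.comp (f := fun r : (EuclideanSpace ℝ (Fin N) × ℝ) × EuclideanSpace ℝ (Fin N) => (r.1.1 - r.2, r.1.2)) (by fun_prop)).measurable
    unfold Function.uncurry
    fun_prop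

lemma phi_hasDerivAt (N : ℕ) (φ : EuclideanSpace ℝ (Fin N) → ℝ → ℝ)
    (h1 : ContDiff ℝ (⊤ : ℕ∞) (Function.uncurry φ)) (x : EuclideanSpace ℝ (Fin N)) (t : ℝ) :
    HasDerivAt (φ x) (fderiv ℝ (Function.uncurry φ) (x, t) (0, 1)) t := by
  have hd : HasFDerivAt (Function.uncurry φ) (fderiv ℝ (Function.uncurry φ) (x, t)) (x, t) :=
    (h1.differentiable (by simp) _).hasFDerivAt
  have hl : HasDerivAt (fun s : ℝ => (x, s)) ((0 : EuclideanSpace ℝ (Fin N)), (1:ℝ)) t :=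
    (hasDerivAt_const t x).prodMk (hasDerivAt_id t)
  exact hd.comp_hasDerivAt t hl

lemma g_bound (N : ℕ) (hN : 1 ≤ N) (θ : ℝ) (hθ : θ ∈ Set.Ioo (0:ℝ) 2)
    (φ : EuclideanSpace ℝ (Fin N) → ℝ → ℝ)
    (h1 : ContDiff ℝ (⊤ : ℕ∞) (Function.uncurry φ))
    (h2 : HasCompactSupport (Function.uncurry φ)) :
    ∃ M : ℝ, ∀ x t, |-(deriv (φ x) t) + fracLap N θ (fun y => φ y t) x| ≤ M := by
  obtain ⟨K, hK, h⟩ := fl_bound N φ h1 h2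
  have hd : ContDiff ℝ 1 (fderiv ℝ (Function.uncurry φ)) := h1.fderiv_right (by norm_cast)
  obtain ⟨D, hD⟩ := (h2.fderiv ℝ).exists_bound_of_continuous hd.continuous
  set c := (Real.Gamma ((N + θ) / 2) / (Real.pi ^ ((N : ℝ) / 2) * Real.Gamma (2 - θ / 2))
      * (θ / 2) * (1 - θ / 2)) / 2 with hc
  have hc0 : 0 ≤ c := const_nonneg N θ hθ
  refine ⟨D * ‖((0 : EuclideanSpace ℝ (Fin N)), (1:ℝ))‖ + c * ∫ z : EuclideanSpace ℝ (Fin N),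
    K * (min 1 (‖z‖ ^ 2) * ‖z‖ ^ (-(N : ℝ) - θ)), fun x t => ?_⟩
  refine (abs_add_le _ _).trans (add_le_add ?_ ?_)
  · rw [abs_neg, (phi_hasDerivAt N φ h1 x t).deriv]
    exact (ContinuousLinearMap.le_opNorm (fderiv ℝ (Function.uncurry φ) (x, t)) (0, 1)).trans
      (mul_le_mul_of_nonneg_right (hD _) (norm_nonneg _))
  · unfold fracLap
    rw [abs_mul, abs_of_nonneg hc0]
    refine mul_le_mul_of_nonneg_left ?_ hc0
    rw [← Real.norm_eq_abs]
    refine norm_integral_le_of_norm_le ((kernel_integrable N hN θ hθ).const_mul K)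
      (Filter.Eventually.of_forall fun z => ?_)
    rw [norm_mul, Real.norm_eq_abs, Real.norm_of_nonneg (by positivity), ← mul_assoc]
    gcongr
    exact h t x z

lemma eps_step (N : ℕ) (hN : 1 ≤ N) (θ : ℝ) (hθ : θ ∈ Set.Ioo (0:ℝ) 2)
    (p q : ℝ) (hpq : p.HolderConjugate q) (m : ℕ) (hm : q ≤ m) (T : ℝ)
    (μ : Measure (EuclideanSpace ℝ (Fin N))) (u : EuclideanSpace ℝ (Fin N) → ℝ → ℝ)
    (hu : IsVeryWeakSupersolutionFrac N θ p T μ u) (τ : ℝ) (hτ : τ ∈ Set.Ioo (0:ℝ) T)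
    (φ : EuclideanSpace ℝ (Fin N) → ℝ → ℝ)
    (h1 : ContDiff ℝ (⊤ : ℕ∞) (Function.uncurry φ))
    (h2 : HasCompactSupport (Function.uncurry φ))
    (h3 : ∀ x t, 0 ≤ φ x t) (h4 : ∀ x, φ x τ = 0) (ε : ℝ) (hε : 0 < ε) :
    (∫ x, FF m q ε (φ x 0) ∂μ) ≤ (m:ℝ) ^ q * ∫ r in tsupport (Function.uncurry φ),
            |(-(deriv (φ r.1) r.2) + fracLap N θ (fun y => φ y r.2) r.1)| ^ q := by
  obtain ⟨hum, hu0, hui, hut⟩ := hu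
  have hq := hpq.symm.lt
  have hm1 : 2 ≤ m := by
    have : (1:ℝ) < m := by linarith
    exact_mod_cast this
  have F0 : FF m q ε 0 = 0 := by simp [FF, show m ≠ 0 by omega]
  have F0' : FF' m q ε 0 = 0 := by
    simp [FF', show m ≠ 0 by omega, show m - 1 ≠ 0 by omega]
  set ψ : EuclideanSpace ℝ (Fin N) → ℝ → ℝ := fun x t => FF m q ε (φ x t) with hψ
  have p1 : ContDiff ℝ (⊤ : ℕ∞) (Function.uncurry ψ) := by
    have : Function.uncurry ψ = fun r => (Function.uncurry φ r) ^ m *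
        (Function.uncurry φ r + ε) ^ (q - m) := by
      ext ⟨x, t⟩; rfl
    rw [this]
    refine (h1.pow m).mul ((h1.add contDiff_const).rpow_const_of_ne fun r => ?_)
    have : 0 ≤ Function.uncurry φ r := h3 r.1 r.2
    positivity
  have p2 : HasCompactSupport (Function.uncurry ψ) := h2.comp_left (g := FF m q ε) F0
  have p3 : ∀ x t, 0 ≤ ψ x t := fun x t => FF_nonneg m q ε _ hε (h3 x t)
  have p4 : ∀ x, ψ x τ = 0 := fun x => by simp only [hψ, h4, F0]
  have main := hut τ hτ ψ p1 p2 p3 p4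
  set g : EuclideanSpace ℝ (Fin N) × ℝ → ℝ := fun r =>
    -(deriv (φ r.1) r.2) + fracLap N θ (fun y => φ y r.2) r.1 with hg
  set S := tsupport (Function.uncurry φ) with hS
  have hSc : IsCompact S := h2
  have hSm : MeasurableSet S := hSc.isClosed.measurableSet
  have hgm : Measurable g := g_meas N θ φ h1
  obtain ⟨M, hM⟩ := g_bound N hN θ hθ φ h1 h2
  have hM0 : 0 ≤ M := (abs_nonneg _).trans (hM 0 0)
  have hgi : IntegrableOn (fun r => |g r| ^ q) S := by
    refine Measure.integrableOn_of_bounded hSc.measure_lt_top.ne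
      (Measurable.aestronglyMeasurable (by fun_prop)) (M := M ^ q)
      (Filter.Eventually.of_forall fun r => ?_)
    rw [Real.norm_of_nonneg (by positivity)]
    have := hM r.1 r.2
    exact Real.rpow_le_rpow (abs_nonneg _) this hpq.symm.pos.le
  set I : Set ℝ := Set.Ioo (0:ℝ) τ with hI
  set B : EuclideanSpace ℝ (Fin N) × ℝ → ℝ :=
    S.indicator (fun r => (m:ℝ) ^ q * |g r| ^ q) with hB
  have hB0 : ∀ r, 0 ≤ B r := fun r => Set.indicator_nonneg (fun _ _ => by positivity) r
  have hBi : Integrable B := (integrable_indicator_iff hSm).2 (hgi.const_mul _)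
  set ν := (volume : Measure (EuclideanSpace ℝ (Fin N))).prod (volume.restrict I) with hν
  have hν' : ν = (volume : Measure (EuclideanSpace ℝ (Fin N) × ℝ)).restrict (univ ×ˢ I) := by
    rw [Measure.volume_eq_prod, ← Measure.prod_restrict, Measure.restrict_univ]
  have hBν : Integrable B ν := by rw [hν']; exact hBi.restrict
  set A : EuclideanSpace ℝ (Fin N) × ℝ → ℝ := fun r => u r.1 r.2 ^ p * ψ r.1 r.2 with hA
  have hAν : Integrable A ν := by
    have hK : IsCompact (Prod.fst '' S) := hSc.image continuous_fst
    have hsupp : Function.support A ⊆ (Prod.fst '' S) ×ˢ (univ : Set ℝ) := by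
      intro r hr
      refine ⟨⟨r, ?_, rfl⟩, mem_univ _⟩
      apply subset_tsupport
      intro h0
      apply hr
      have h0' : φ r.1 r.2 = 0 := h0
      simp only [hA, hψ, h0', F0, mul_zero]
    rw [← integrableOn_iff_integrable_of_support_subset hsupp]
    have hi := (hui _ hK τ hτ).2
    have hmeas : ν.restrict ((Prod.fst '' S) ×ˢ (univ : Set ℝ)) =
        (volume : Measure (EuclideanSpace ℝ (Fin N) × ℝ)).restrict ((Prod.fst '' S) ×ˢ I) := by
      rw [hν, ← Measure.prod_restrict, Measure.restrict_univ, Measure.volume_eq_prod,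
        ← Measure.prod_restrict]
    unfold IntegrableOn
    rw [hmeas]
    obtain ⟨P, hP⟩ := p2.exists_bound_of_continuous p1.continuous
    exact Integrable.mul_bdd (c := P) hi p1.continuous.aestronglyMeasurable
      (Filter.Eventually.of_forall fun r => hP r)
  have hA0 : ∀ x, ∀ t ∈ I, 0 ≤ A (x, t) := fun x t ht =>
    mul_nonneg (Real.rpow_nonneg (hu0 x t ⟨ht.1, ht.2.trans hτ.2⟩) _) (p3 x t)
  -- pointwise bound
  have pt : ∀ x, ∀ t ∈ I,
      u x t * (-(deriv (ψ x) t) + fracLap N θ (fun y => ψ y t) x) ≤ A (x, t) + B (x, t) := by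
    intro x t ht
    have hut0 := hu0 x t ⟨ht.1, ht.2.trans hτ.2⟩
    have hder : deriv (ψ x) t = FF' m q ε (φ x t) * deriv (φ x) t := by
      have e1 := (phi_hasDerivAt N φ h1 x t)
      rw [e1.deriv]
      exact ((FF_hasDeriv m q ε (φ x t) hε (h3 x t)).comp t e1).deriv
    have hfl := fracLap_comp_le N hN θ hθ φ ψ h1 h2 p1 p2 x t (FF' m q ε (φ x t))
      (fun y => FF_tangent m q ε hq hm hε _ _ (h3 x t) (h3 y t))
    have hle : -(deriv (ψ x) t) + fracLap N θ (fun y => ψ y t) x ≤ FF' m q ε (φ x t) * g (x, t) := by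
      rw [hder]; simp only [hg]; linarith
    refine (mul_le_mul_of_nonneg_left hle hut0).trans ?_
    rcases eq_or_lt_of_le (h3 x t) with h0 | hpos
    · rw [← h0, F0']
      have := hA0 x t ht
      have := hB0 (x, t)
      simp only [zero_mul, mul_zero]; linarith
    · have hmem : (x, t) ∈ S := subset_tsupport _ (by
        simp only [Function.mem_support, Function.uncurry]; exact hpos.ne')
      have : B (x, t) = (m:ℝ) ^ q * |g (x, t)| ^ q := Set.indicator_of_mem hmem _
      rw [this]
      exact FF_young m p q ε hpq hm hε _ _ _ hpos hut0
  have hABν := hAν.add hBν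
  have step : (∫ t in I, ∫ x, u x t * (-(deriv (ψ x) t) + fracLap N θ (fun y => ψ y t) x)) ≤
      ∫ t in I, ∫ x, (A (x, t) + B (x, t)) := by
    have hnn : ∀ t ∈ I, 0 ≤ ∫ x, (A (x, t) + B (x, t)) := fun t ht =>
      integral_nonneg fun x => add_nonneg (hA0 x t ht) (hB0 _)
    by_cases hint : IntegrableOn (fun t => ∫ x, u x t * (-(deriv (ψ x) t) +
        fracLap N θ (fun y => ψ y t) x)) I
    · refine integral_mono_ae hint hABν.integral_prod_right ?_
      filter_upwards [hABν.prod_left_ae, ae_restrict_mem (measurableSet_Ioo)] with t hti ht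
      by_cases hx : Integrable (fun x => u x t * (-(deriv (ψ x) t) +
        fracLap N θ (fun y => ψ y t) x))
      · exact integral_mono hx hti fun x => pt x t ht
      · rw [integral_undef hx]; exact hnn t ht
    · rw [integral_undef hint]
      exact setIntegral_nonneg measurableSet_Ioo hnn
  have split : (∫ t in I, ∫ x, (A (x, t) + B (x, t))) =
      (∫ t in I, ∫ x, u x t ^ p * ψ x t) + ∫ r, B r ∂ν := by
    have e1 := integral_prod_symm _ hABν
    have e2 := integral_add hAν hBν
    have e3 := integral_prod_symm _ hAν
    simp only [Pi.add_apply] at e1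
    rw [← e1, e2, e3]
  have last : ∫ r, B r ∂ν ≤ (m:ℝ) ^ q * ∫ r in S, |g r| ^ q := by
    rw [← integral_const_mul, ← integral_indicator hSm, hν']
    exact setIntegral_le_integral hBi (Filter.Eventually.of_forall hB0)
  have : (∫ x, ψ x 0 ∂μ) ≤ (m:ℝ) ^ q * ∫ r in S, |g r| ^ q := by
    linarith
  exact this

/-- The basic test-function inequality (Lemma 2.1) for very weak supersolutions of the
fractional semilinear heat equation. -/
theorem stmt_6 (N : ℕ) (hN : 1 ≤ N) (θ : ℝ) (hθ : θ ∈ Set.Ioo (0:ℝ) 2)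
    (p : ℝ) (hp : 1 < p) :
    ∃ C : ℝ, 0 < C ∧ ∀ T : ℝ, 0 < T →
      ∀ μ : Measure (EuclideanSpace ℝ (Fin N)), IsFiniteMeasureOnCompacts μ →
      (∃ u, IsVeryWeakSupersolutionFrac N θ p T μ u) →
      ∀ τ ∈ Set.Ioo (0:ℝ) T, ∀ φ : EuclideanSpace ℝ (Fin N) → ℝ → ℝ,
        ContDiff ℝ (⊤ : ℕ∞) (Function.uncurry φ) →
        HasCompactSupport (Function.uncurry φ) →
        (∀ x t, 0 ≤ φ x t) →
        (∀ x, φ x τ = 0) →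
        (∫ x, φ x 0 ^ (p/(p-1)) ∂μ) ≤
          C * ∫ q in tsupport (Function.uncurry φ),
            |(-(deriv (φ q.1) q.2) + fracLap N θ (fun y => φ y q.2) q.1)| ^ (p/(p-1)) := by
  have hpq : p.HolderConjugate (p/(p-1)) := Real.HolderConjugate.conjExponent hp
  set q := p/(p-1) with hqdef
  obtain ⟨m, hm⟩ := exists_nat_ge q
  have hq0 := hpq.symm.pos
  have hmp : (0:ℝ) < m := by linarith
  refine ⟨(m:ℝ) ^ q, by positivity, ?_⟩
  rintro T hT μ hμ ⟨u, hu⟩ τ hτ φ h1 h2 h3 h4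
  have hstep := eps_step N hN θ hθ p q hpq m hm T μ u hu τ hτ φ h1 h2 h3 h4
  have hc0 : Continuous (fun x => φ x 0) :=
    h1.continuous.comp (f := fun x => (x, (0:ℝ))) (by fun_prop)
  have hcs : HasCompactSupport (fun x => φ x 0) := by
    refine HasCompactSupport.of_support_subset_isCompact (h2.image continuous_fst) ?_
    intro x hx
    exact ⟨(x, 0), subset_tsupport _ hx, rfl⟩
  have hcq : Continuous (fun x => φ x 0 ^ q) := hc0.rpow_const fun x => Or.inr hq0.le
  have hcsq : HasCompactSupport (fun x => φ x 0 ^ q) :=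
    hcs.comp_left (g := fun s : ℝ => s ^ q) (Real.zero_rpow hq0.ne')
  have hint : Integrable (fun x => φ x 0 ^ q) μ := hcq.integrable_of_hasCompactSupport hcsq
  have hlim : Filter.Tendsto (fun n : ℕ => ∫ x, FF m q (1 / ((n:ℝ) + 1)) (φ x 0) ∂μ)
      Filter.atTop (nhds (∫ x, φ x 0 ^ q ∂μ)) := by
    have hm0 : m ≠ 0 := by rintro rfl; simp at hmp
    refine tendsto_integral_of_dominated_convergence _ ?_ hint ?_ ?_
    · intro n
      have : Continuous fun x => FF m q (1 / ((n:ℝ) + 1)) (φ x 0) := by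
        unfold FF
        refine (hc0.pow m).mul ((hc0.add continuous_const).rpow_const fun x => Or.inl ?_)
        have := h3 x 0
        have hε : (0:ℝ) < 1 / ((n:ℝ) + 1) := by positivity
        exact (add_pos_of_nonneg_of_pos this hε).ne'
      exact this.aestronglyMeasurable
    · intro n
      refine Filter.Eventually.of_forall fun x => ?_
      have hε : (0:ℝ) < 1 / ((n:ℝ) + 1) := by positivity
      rw [Real.norm_of_nonneg (FF_nonneg _ _ _ _ hε (h3 x 0))]
      rcases eq_or_lt_of_le (h3 x 0) with h0 | hs
      · rw [← h0]; simp [FF, hm0, Real.zero_rpow hq0.ne']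
      · have e : φ x 0 ^ q = φ x 0 ^ m * φ x 0 ^ (q - m) := by
          rw [← Real.rpow_natCast, ← Real.rpow_add hs]; congr 1; ring
        rw [e]; unfold FF
        refine mul_le_mul_of_nonneg_left ?_ (by positivity)
        exact Real.rpow_le_rpow_of_nonpos hs (by linarith) (by linarith)
    · refine Filter.Eventually.of_forall fun x => ?_
      rcases eq_or_lt_of_le (h3 x 0) with h0 | hs
      · rw [← h0]; simp [FF, hm0, Real.zero_rpow hq0.ne']
      · have e : φ x 0 ^ q = φ x 0 ^ m * (φ x 0 + 0) ^ (q - m) := by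
          rw [add_zero, ← Real.rpow_natCast, ← Real.rpow_add hs]; congr 1; ring
        rw [e]; unfold FF
        refine Filter.Tendsto.const_mul _ ?_
        refine Filter.Tendsto.rpow_const ?_ (Or.inl (by simpa using hs.ne'))
        exact tendsto_const_nhds.add tendsto_one_div_add_atTop_nhds_zero_nat
  exact le_of_tendsto' hlim fun n => hstep _ (by positivity)
end

section
/- Let N ≥ 1 be an integer, θ ∈ (0,2), q > 1, and let φ : ℝ^N → [0,∞) be smooth and compactly supported. Then for every x ∈ ℝ^N and every ε > 0, ∫_{|z| ≥ ε} (2φ(x)^q − φ(x+z)^q − φ(x−z)^q) |z|^{−N−θ} dz ≤ q φ(x)^{q−1} ∫_{|z| ≥ ε} (2φ(x) − φ(x+z) − φ(x−z)) |z|^{−N−θ} dz, both integrals being absolutely convergent. (This is the truncated form of the inequality (−Δ)^{θ/2}(φ^{q}) ≤ q φ^{q−1} (−Δ)^{θ/2}φ with q = p/(p−1).) -/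
open MeasureTheory Real Set

lemma aux_conv (q : ℝ) (hq : 1 < q) (a b : ℝ) (ha : 0 ≤ a) (hb : 0 ≤ b) :
    a ^ q - b ^ q ≤ q * a ^ (q - 1) * (a - b) := by
  rcases ha.eq_or_lt with h | h
  · subst h
    rw [Real.zero_rpow (by linarith), Real.zero_rpow (by linarith)]
    have := Real.rpow_nonneg hb q
    simpa using this
  · have h1 := one_add_mul_self_le_rpow_one_add (s := b / a - 1)
      (by have : 0 ≤ b / a := by positivity
          linarith) hq.le
    rw [show 1 + (b / a - 1) = b / a by ring, Real.div_rpow hb ha] at h1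
    have hp : 0 < a ^ q := Real.rpow_pos_of_pos h q
    rw [le_div_iff₀ hp] at h1
    have h2 : a ^ q = a ^ (q - 1) * a := by
      rw [← Real.rpow_add_one h.ne']; ring_nf
    have h3 : (1 + q * (b / a - 1)) * a ^ q = a ^ q + q * a ^ (q - 1) * (b - a) := by
      have : (b / a - 1) * a ^ q = a ^ (q - 1) * (b - a) := by
        rw [h2]; field_simp
      linear_combination q * this
    linarith [h3]

lemma aux_ker (N : ℕ) (θ : ℝ) (hθ : 0 < θ) (ε : ℝ) (hε : 0 < ε) :
    IntegrableOn (fun z : EuclideanSpace ℝ (Fin N) => ‖z‖ ^ (-(N:ℝ) - θ))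
      {z : EuclideanSpace ℝ (Fin N) | ε ≤ ‖z‖} := by
  have hm : MeasurableSet {z : EuclideanSpace ℝ (Fin N) | ε ≤ ‖z‖} :=
    measurableSet_le measurable_const measurable_norm
  have h := (integrable_one_add_norm (E := EuclideanSpace ℝ (Fin N)) (μ := volume)
    (r := (N:ℝ) + θ) (by simp [hθ])).const_mul ((ε / (1 + ε)) ^ (-((N:ℝ) + θ)))
  refine Integrable.mono' h.integrableOn
    (measurable_norm.pow_const _).aestronglyMeasurable ?_
  filter_upwards [ae_restrict_mem hm] with z hz
  have hz : ε ≤ ‖z‖ := hz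
  rw [Real.norm_of_nonneg (by positivity), ← Real.mul_rpow (by positivity) (by positivity),
    show -(N:ℝ) - θ = -((N:ℝ) + θ) by ring]
  refine Real.rpow_le_rpow_of_nonpos (by positivity) ?_ (by have : (0:ℝ) ≤ N := by positivity
                                                            linarith)
  rw [div_mul_eq_mul_div, div_le_iff₀ (by positivity)]
  nlinarith

lemma aux_int (N : ℕ) (θ : ℝ) (hθ : 0 < θ) (ε : ℝ) (hε : 0 < ε)
    (ψ : EuclideanSpace ℝ (Fin N) → ℝ) (hc : Continuous ψ) (hs : HasCompactSupport ψ)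
    (x : EuclideanSpace ℝ (Fin N)) :
    IntegrableOn (fun z : EuclideanSpace ℝ (Fin N) =>
      (2 * ψ x - ψ (x + z) - ψ (x - z)) * ‖z‖ ^ (-(N:ℝ) - θ))
      {z : EuclideanSpace ℝ (Fin N) | ε ≤ ‖z‖} := by
  obtain ⟨C, hC⟩ := hc.bounded_above_of_compact_support hs
  refine Integrable.bdd_mul (c := 4 * C) (aux_ker N θ hθ ε hε)
    (by fun_prop) (ae_of_all _ fun z => ?_)
  have h1 := abs_le.1 (hC x)
  have h2 := abs_le.1 (hC (x + z))
  have h3 := abs_le.1 (hC (x - z))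
  exact abs_le.2 ⟨by linarith, by linarith⟩

/-- Truncated form of the convexity inequality `(-Δ)^{θ/2}(φ^q) ≤ q φ^{q-1} (-Δ)^{θ/2}φ`
for nonnegative smooth compactly supported `φ` and `q > 1`. -/
theorem stmt_8 (N : ℕ) (hN : 1 ≤ N) (θ : ℝ) (hθ : θ ∈ Set.Ioo (0:ℝ) 2)
    (q : ℝ) (hq : 1 < q) (φ : EuclideanSpace ℝ (Fin N) → ℝ)
    (hφ_smooth : ContDiff ℝ (⊤ : ℕ∞) φ) (hφ_supp : HasCompactSupport φ)
    (hφ_nonneg : ∀ x, 0 ≤ φ x)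
    (x : EuclideanSpace ℝ (Fin N)) (ε : ℝ) (hε : 0 < ε) :
    IntegrableOn
      (fun z : EuclideanSpace ℝ (Fin N) =>
        (2 * φ x ^ q - φ (x + z) ^ q - φ (x - z) ^ q) * ‖z‖ ^ (-(N:ℝ) - θ))
      {z : EuclideanSpace ℝ (Fin N) | ε ≤ ‖z‖} ∧
    IntegrableOn
      (fun z : EuclideanSpace ℝ (Fin N) =>
        (2 * φ x - φ (x + z) - φ (x - z)) * ‖z‖ ^ (-(N:ℝ) - θ))
      {z : EuclideanSpace ℝ (Fin N) | ε ≤ ‖z‖} ∧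
    (∫ z in {z : EuclideanSpace ℝ (Fin N) | ε ≤ ‖z‖},
        (2 * φ x ^ q - φ (x + z) ^ q - φ (x - z) ^ q) * ‖z‖ ^ (-(N:ℝ) - θ)) ≤
      q * φ x ^ (q - 1) *
        ∫ z in {z : EuclideanSpace ℝ (Fin N) | ε ≤ ‖z‖},
          (2 * φ x - φ (x + z) - φ (x - z)) * ‖z‖ ^ (-(N:ℝ) - θ) := by
  have hm : MeasurableSet {z : EuclideanSpace ℝ (Fin N) | ε ≤ ‖z‖} :=
    measurableSet_le measurable_const measurable_norm
  have hc := hφ_smooth.continuous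
  have h1 := aux_int N θ hθ.1 ε hε (fun y => φ y ^ q)
    (hc.rpow_const fun _ => Or.inr (by linarith))
    (hφ_supp.comp_left (g := fun t : ℝ => t ^ q) (Real.zero_rpow (by linarith))) x
  have h2 := aux_int N θ hθ.1 ε hε φ hc hφ_supp x
  refine ⟨h1, h2, ?_⟩
  rw [← integral_const_mul]
  refine setIntegral_mono_on h1 (h2.const_mul _) hm fun z _ => ?_
  rw [← mul_assoc]
  refine mul_le_mul_of_nonneg_right ?_ (by positivity)
  have a1 := aux_conv q hq _ _ (hφ_nonneg x) (hφ_nonneg (x + z))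
  have a2 := aux_conv q hq _ _ (hφ_nonneg x) (hφ_nonneg (x - z))
  linarith
end

section
/- Let N ≥ 1 be an integer and θ ∈ (0,2]. There exists a constant C > 0 depending only on N and θ such that for every a ∈ (0, 1/64), ∫_0^1 ∫_{B(0,1)} 1_{{2a ≤ |x|^θ + t ≤ 1/2}} (|x|^θ + t)^{−(N+θ)/θ} dx dt ≤ C log(1/a), where the indicator restricts the integration to the set {(x,t) ∈ B(0,1) × (0,1) : 2a ≤ |x|^θ + t ≤ 1/2}. -/
open MeasureTheory Real Set

lemma aux_pt (N : ℕ) (θ : ℝ) (hθ : 0 < θ) (a t n : ℝ) (ha : 0 < a) (ht : 0 < t) (hn : 0 ≤ n)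
    (h : 2 * a ≤ n ^ θ + t) :
    (n ^ θ + t) ^ (-(((N:ℝ) + θ) / θ)) ≤
      ((2 ^ θ * 3)⁻¹ * (t + a)) ^ (-(((N:ℝ) + θ) / θ)) *
        (1 + ((t + a) ^ (1 / θ))⁻¹ * n) ^ (-((N:ℝ) + θ)) := by
  have hτ : 0 < t + a := by linarith
  set r := (t + a) ^ (1 / θ) with hr
  have hr0 : 0 < r := rpow_pos_of_pos hτ _
  have hrθ : r ^ θ = t + a := by
    rw [hr, ← rpow_mul hτ.le, one_div_mul_cancel hθ.ne', rpow_one]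
  have hnθ : 0 ≤ n ^ θ := rpow_nonneg hn _
  set u := r⁻¹ * n with hu
  have hu0 : 0 ≤ u := by positivity
  have huθ : u ^ θ = (t + a)⁻¹ * n ^ θ := by
    rw [hu, mul_rpow (by positivity) hn, inv_rpow hr0.le, hrθ]
  have h1 : (1 + u) ^ θ ≤ 2 ^ θ * (1 + u ^ θ) := by
    have hm : (1 + u) ^ θ ≤ (2 * max 1 u) ^ θ := by
      apply rpow_le_rpow (by positivity) _ hθ.le
      linarith [le_max_left 1 u, le_max_right 1 u]
    rw [mul_rpow (by norm_num) (by positivity)] at hm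
    refine hm.trans ?_
    gcongr
    have : 0 ≤ u ^ θ := rpow_nonneg hu0 _
    rcases max_choice 1 u with h | h <;> rw [h]
    · rw [one_rpow]; linarith
    · linarith
  have h2 : (t + a) * (1 + u ^ θ) ≤ 3 * (n ^ θ + t) := by
    rw [huθ, mul_add, mul_inv_cancel_left₀ hτ.ne']; linarith
  have h2t : (0:ℝ) < 2 ^ θ := by positivity
  have h3 : (2 ^ θ * 3)⁻¹ * (t + a) * (1 + u) ^ θ ≤ n ^ θ + t := by
    rw [mul_assoc, inv_mul_le_iff₀ (by positivity)]
    calc (t + a) * (1 + u) ^ θ ≤ (t + a) * (2 ^ θ * (1 + u ^ θ)) := by gcongr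
      _ = 2 ^ θ * ((t + a) * (1 + u ^ θ)) := by ring
      _ ≤ 2 ^ θ * (3 * (n ^ θ + t)) := by gcongr
      _ = _ := by ring
  have h4 : (1 + u) ^ (-((N:ℝ) + θ)) = ((1 + u) ^ θ) ^ (-(((N:ℝ) + θ) / θ)) := by
    rw [← rpow_mul (by positivity)]
    congr 1
    field_simp
  rw [h4, ← mul_rpow (by positivity) (by positivity)]
  apply rpow_le_rpow_of_nonpos (by positivity) h3
  have : 0 ≤ ((N:ℝ) + θ) / θ := by positivity
  linarith

lemma aux_inner (N : ℕ) (θ : ℝ) (hθ : 0 < θ) (a t : ℝ) (ha : 0 < a) (ht : 0 < t) :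
    (∫ x in {x : EuclideanSpace ℝ (Fin N) |
            x ∈ Metric.ball (0 : EuclideanSpace ℝ (Fin N)) 1 ∧
            2 * a ≤ ‖x‖ ^ θ + t ∧ ‖x‖ ^ θ + t ≤ 1/2},
          (‖x‖ ^ θ + t) ^ (-(((N:ℝ) + θ) / θ))) ≤
     ((2 ^ θ * 3)⁻¹ ^ (-(((N:ℝ) + θ) / θ)) *
      ∫ x : EuclideanSpace ℝ (Fin N), (1 + ‖x‖) ^ (-((N:ℝ) + θ))) * (t + a)⁻¹ := by
  have hτ : 0 < t + a := by linarith
  set r := (t + a) ^ (1 / θ) with hr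
  have hr0 : 0 < r := rpow_pos_of_pos hτ _
  have hint : Integrable (fun x : EuclideanSpace ℝ (Fin N) => (1 + ‖x‖) ^ (-((N:ℝ) + θ))) := by
    apply integrable_one_add_norm
    simp [hθ]
  have hint2 := (hint.comp_smul (R := r⁻¹) (by positivity)).const_mul
    (((2 ^ θ * 3)⁻¹ * (t + a)) ^ (-(((N:ℝ) + θ) / θ)))
  have hmeas : MeasurableSet {x : EuclideanSpace ℝ (Fin N) |
            x ∈ Metric.ball (0 : EuclideanSpace ℝ (Fin N)) 1 ∧
            2 * a ≤ ‖x‖ ^ θ + t ∧ ‖x‖ ^ θ + t ≤ 1/2} := by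
    have hm : Measurable (fun x : EuclideanSpace ℝ (Fin N) => ‖x‖ ^ θ + t) := by fun_prop
    exact measurableSet_ball.inter ((measurableSet_le measurable_const hm).inter
      (measurableSet_le hm measurable_const))
  refine (integral_mono_of_nonneg (Filter.Eventually.of_forall fun x => ?_)
    hint2.integrableOn ((ae_restrict_mem hmeas).mono fun x hx => ?_)).trans
      ((setIntegral_le_integral hint2 (Filter.Eventually.of_forall fun x => ?_)).trans ?_)
  · simp only [Pi.zero_apply]; positivity
  · have := aux_pt N θ hθ a t ‖x‖ ha ht (norm_nonneg _) hx.2.1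
    rw [← hr] at this
    simpa [norm_smul, abs_of_pos hr0] using this
  · simp only [Pi.zero_apply]; positivity
  · rw [integral_const_mul, Measure.integral_comp_smul volume
      (fun x : EuclideanSpace ℝ (Fin N) => (1 + ‖x‖) ^ (-((N:ℝ) + θ))) r⁻¹]
    rw [mul_rpow (by positivity) hτ.le, finrank_euclideanSpace_fin, inv_pow, inv_inv,
      abs_of_pos (by positivity), smul_eq_mul]
    have hk : (t + a) ^ (-(((N:ℝ) + θ) / θ)) * r ^ N = (t + a)⁻¹ := by
      rw [← rpow_natCast, hr, ← rpow_mul hτ.le, ← rpow_add hτ, ← rpow_neg_one]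
      congr 1
      field_simp
      ring
    rw [← hk]
    apply le_of_eq
    ring

/-- Logarithmic bound for the critical integral over the region
`{2a ≤ |x|^θ + t ≤ 1/2}` in `B(0,1) × (0,1)`. -/
theorem stmt_12 (N : ℕ) (hN : 1 ≤ N) (θ : ℝ) (hθ : θ ∈ Set.Ioc (0:ℝ) 2) :
    ∃ C : ℝ, 0 < C ∧ ∀ a : ℝ, a ∈ Set.Ioo (0:ℝ) (1/64) →
      (∫ t in Set.Ioo (0:ℝ) 1,
        ∫ x in {x : EuclideanSpace ℝ (Fin N) |
            x ∈ Metric.ball (0 : EuclideanSpace ℝ (Fin N)) 1 ∧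
            2 * a ≤ ‖x‖ ^ θ + t ∧ ‖x‖ ^ θ + t ≤ 1/2},
          (‖x‖ ^ θ + t) ^ (-(((N:ℝ) + θ) / θ))) ≤ C * Real.log (1/a) := by
  set D : ℝ := ((2 ^ θ * 3)⁻¹ ^ (-(((N:ℝ) + θ) / θ)) *
      ∫ x : EuclideanSpace ℝ (Fin N), (1 + ‖x‖) ^ (-((N:ℝ) + θ))) with hD
  have hD0 : 0 ≤ D := by
    apply mul_nonneg (by positivity)
    exact integral_nonneg fun x => by positivity
  refine ⟨2 * (D + 1), by positivity, fun a ha => ?_⟩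
  obtain ⟨ha0, ha1⟩ := ha
  have hII : IntervalIntegrable (fun t : ℝ => D * (t + a)⁻¹) volume 0 1 := by
    apply ContinuousOn.intervalIntegrable
    apply continuousOn_const.mul
    apply ContinuousOn.inv₀ (by fun_prop)
    intro x hx
    rw [uIcc_of_le zero_le_one] at hx
    linarith [hx.1]
  have hI : IntegrableOn (fun t : ℝ => D * (t + a)⁻¹) (Set.Ioo 0 1) :=
    ((intervalIntegrable_iff_integrableOn_Ioo_of_le zero_le_one).1 hII)
  refine (integral_mono_of_nonneg ((ae_restrict_mem measurableSet_Ioo).mono fun t ht => ?_) hI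
    ((ae_restrict_mem measurableSet_Ioo).mono fun t ht =>
      aux_inner N θ hθ.1 a t ha0 ht.1)).trans ?_
  · have := ht.1
    exact integral_nonneg fun x => by positivity
  · rw [← integral_Ioc_eq_integral_Ioo, ← intervalIntegral.integral_of_le zero_le_one,
      intervalIntegral.integral_const_mul,
      intervalIntegral.integral_comp_add_right (fun x : ℝ => x⁻¹) a,
      integral_inv_of_pos (by linarith) (by linarith)]
    have hl : 0 ≤ log (1 / a) := log_nonneg (by rw [le_div_iff₀ ha0]; linarith)
    have : log ((1 + a) / (0 + a)) ≤ 2 * log (1 / a) := by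
      rw [← log_rpow (by positivity)]
      apply log_le_log (by positivity)
      rw [rpow_two, zero_add, div_pow, div_le_div_iff₀ ha0 (by positivity)]
      nlinarith
    nlinarith [mul_le_mul_of_nonneg_left this hD0]
end

section
/- Let N ≥ 1 be an integer, θ ∈ (0,2], β > 0, K > 0, and T > 0, and let μ be a nonnegative Radon measure on ℝ^N. Fix τ ∈ (T/2, T), and suppose that μ(B(z, δ τ^{1/θ})) ≤ K [log(e + δ^{−θ})]^{−β} for every z ∈ ℝ^N and every δ > 0 with δ^θ < 1/64. Then there exists a constant C > 0 depending only on N, θ, and β such that μ(B(z, σ)) ≤ C K [log(e + T^{1/θ}/σ)]^{−β} for every z ∈ ℝ^N and every σ ∈ (0, T^{1/θ}). -/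
open MeasureTheory Real Set

/-- Upgrade, via a covering argument, of a logarithmic bound on measures of balls of
radii `δ τ^{1/θ}` with `δ^θ < 1/64` to a logarithmic bound for all radii `σ < T^{1/θ}`. -/
theorem stmt_13 (N : ℕ) (hN : 1 ≤ N) (θ : ℝ) (hθ : θ ∈ Set.Ioc (0:ℝ) 2)
    (β : ℝ) (hβ : 0 < β) :
    ∃ C : ℝ, 0 < C ∧ ∀ K : ℝ, 0 < K → ∀ T : ℝ, 0 < T →
      ∀ μ : Measure (EuclideanSpace ℝ (Fin N)), IsFiniteMeasureOnCompacts μ →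
      ∀ τ : ℝ, τ ∈ Set.Ioo (T/2) T →
      (∀ z : EuclideanSpace ℝ (Fin N), ∀ δ : ℝ, 0 < δ → δ ^ θ < 1/64 →
        μ (Metric.ball z (δ * τ ^ (1/θ))) ≤
          ENNReal.ofReal (K * (Real.log (Real.exp 1 + δ ^ (-θ))) ^ (-β))) →
      ∀ z : EuclideanSpace ℝ (Fin N), ∀ σ : ℝ, 0 < σ → σ < T ^ (1/θ) →
        μ (Metric.ball z σ) ≤
          ENNReal.ofReal (C * K * (Real.log (Real.exp 1 + T ^ (1/θ) / σ)) ^ (-β)) := by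
  obtain ⟨hθ0, hθ2⟩ := hθ
  set ε : ℝ := (1/128 : ℝ) ^ (1/θ) with hε
  have hε0 : 0 < ε := by positivity
  have hinv : ∀ a : ℝ, 0 ≤ a → (a ^ (1/θ)) ^ θ = a := by
    intro a ha
    rw [← Real.rpow_mul ha, one_div_mul_cancel hθ0.ne', Real.rpow_one]
  have htb : TotallyBounded (Metric.ball (0 : EuclideanSpace ℝ (Fin N)) 1) :=
    (isCompact_closedBall (0 : EuclideanSpace ℝ (Fin N)) 1).totallyBounded.subset
      Metric.ball_subset_closedBall
  obtain ⟨t, htf, ht⟩ := Metric.totallyBounded_iff.1 htb ε hε0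
  set s := htf.toFinset with hs
  refine ⟨(s.card + 1) * (θ/2) ^ (-β), by positivity, ?_⟩
  intro K hK T hT μ _ τ ⟨hτ1, hτ2⟩ h z σ hσ hσT
  have hτ : 0 < τ := by linarith
  have hτp : 0 < τ ^ (1/θ) := by positivity
  have hTp : 0 < T ^ (1/θ) := by positivity
  set δ := ε * σ / τ ^ (1/θ) with hδ
  have hδ0 : 0 < δ := by positivity
  have hδθ : δ ^ θ = (1/128) * σ ^ θ / τ := by
    rw [hδ, Real.div_rpow (by positivity) hτp.le, Real.mul_rpow hε0.le hσ.le, hinv _ hτ.le,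
      hε, hinv _ (by norm_num)]
  have hσθ0 : 0 < σ ^ θ := by positivity
  have hσθ : σ ^ θ < T := by
    have := Real.rpow_lt_rpow hσ.le hσT hθ0
    rwa [hinv _ hT.le] at this
  have hδ64 : δ ^ θ < 1/64 := by
    rw [hδθ, div_lt_iff₀ hτ]; linarith
  set x := T ^ (1/θ) / σ with hx
  have hx1 : 1 ≤ x := by rw [hx, le_div_iff₀ hσ]; linarith
  have hx0 : 0 < x := by linarith
  have hxθ : x ^ θ = T / σ ^ θ := by
    rw [hx, Real.div_rpow hTp.le hσ.le, hinv _ hT.le]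
  have hδx : x ^ θ ≤ δ ^ (-θ) := by
    rw [Real.rpow_neg hδ0.le, hδθ, hxθ, inv_div, div_le_div_iff₀ hσθ0 (by positivity)]
    nlinarith
  have he1 : 1 ≤ Real.exp 1 := Real.one_le_exp (by norm_num)
  have hsub : (Real.exp 1 + x) ^ (θ/2) ≤ Real.exp 1 + δ ^ (-θ) := by
    have h1 := Real.rpow_add_le_add_rpow (p := θ/2) (Real.exp_pos 1).le hx0.le (by positivity) (by linarith)
    have h2 : Real.exp 1 ^ (θ/2) ≤ Real.exp 1 := by
      simpa using Real.rpow_le_rpow_of_exponent_le he1 (show θ/2 ≤ 1 by linarith)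
    have h3 : x ^ (θ/2) ≤ x ^ θ := Real.rpow_le_rpow_of_exponent_le hx1 (by linarith)
    linarith
  have hlog : θ/2 * Real.log (Real.exp 1 + x) ≤ Real.log (Real.exp 1 + δ ^ (-θ)) := by
    rw [← Real.log_rpow (by positivity)]
    exact Real.log_le_log (by positivity) hsub
  have hl0 : 0 < Real.log (Real.exp 1 + x) := Real.log_pos (by linarith)
  have hpow : (Real.log (Real.exp 1 + δ ^ (-θ))) ^ (-β) ≤
      (θ/2) ^ (-β) * (Real.log (Real.exp 1 + x)) ^ (-β) := by
    rw [← Real.mul_rpow (by positivity) hl0.le]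
    exact Real.rpow_le_rpow_of_nonpos (by positivity) hlog (by linarith)
  have hcov : Metric.ball z σ ⊆ ⋃ y ∈ s, Metric.ball (z + σ • y) (δ * τ ^ (1/θ)) := by
    intro w hw
    have hmem : σ⁻¹ • (w - z) ∈ Metric.ball (0 : EuclideanSpace ℝ (Fin N)) 1 := by
      rw [Metric.mem_ball, dist_eq_norm] at hw
      rw [mem_ball_zero_iff, norm_smul, norm_inv, Real.norm_of_nonneg hσ.le,
        inv_mul_lt_iff₀ hσ]
      linarith
    obtain ⟨y, hy, hyw⟩ := Set.mem_iUnion₂.1 (ht hmem)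
    refine Set.mem_iUnion₂.2 ⟨y, by simpa [hs] using hy, ?_⟩
    have heq : w - (z + σ • y) = σ • (σ⁻¹ • (w - z) - y) := by
      rw [smul_sub, smul_inv_smul₀ hσ.ne']; abel
    rw [Metric.mem_ball, dist_eq_norm] at hyw ⊢
    rw [heq, norm_smul, Real.norm_of_nonneg hσ.le, hδ, div_mul_cancel₀ _ hτp.ne', mul_comm]
    exact mul_lt_mul_of_pos_right hyw hσ
  calc μ (Metric.ball z σ) ≤ μ (⋃ y ∈ s, Metric.ball (z + σ • y) (δ * τ ^ (1/θ))) :=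
        measure_mono hcov
    _ ≤ ∑ y ∈ s, μ (Metric.ball (z + σ • y) (δ * τ ^ (1/θ))) := measure_biUnion_finset_le _ _
    _ ≤ ∑ y ∈ s, ENNReal.ofReal (K * (Real.log (Real.exp 1 + δ ^ (-θ))) ^ (-β)) :=
        Finset.sum_le_sum fun y _ => h _ δ hδ0 hδ64
    _ = ENNReal.ofReal (s.card * (K * (Real.log (Real.exp 1 + δ ^ (-θ))) ^ (-β))) := by
        rw [Finset.sum_const, nsmul_eq_mul, ENNReal.ofReal_mul (Nat.cast_nonneg s.card),
          ENNReal.ofReal_natCast]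
    _ ≤ _ := by
        apply ENNReal.ofReal_le_ofReal
        have hP : 0 ≤ (θ/2) ^ (-β) * (Real.log (Real.exp 1 + x)) ^ (-β) := by positivity
        calc (s.card : ℝ) * (K * (Real.log (Real.exp 1 + δ ^ (-θ))) ^ (-β))
            ≤ (s.card : ℝ) * (K * ((θ/2) ^ (-β) * (Real.log (Real.exp 1 + x)) ^ (-β))) := by
              gcongr
          _ ≤ ((s.card : ℝ) + 1) * (K * ((θ/2) ^ (-β) * (Real.log (Real.exp 1 + x)) ^ (-β))) := by
              gcongr; linarith
          _ = _ := by ring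
end

section
/- Let N ≥ 1 be an integer, p > 1, and T ∈ (0,∞). Let u : ℝ^N × (0,T) → [0,∞] be measurable and suppose that for every t ∈ (0,T) and almost every x ∈ ℝ^N, u(x,t) < ∞ and u(x,t) ≥ ∫_0^t ∫_{ℝ^N} Γ_2(x−y, t−s) u(y,s)^p dy ds, where Γ_2(x,t) = (4πt)^{−N/2} exp(−|x|²/(4t)). Then u^p is locally integrable on ℝ^N × [0,T); that is, ∫_0^{T'} ∫_K u(y,s)^p dy ds < ∞ for every compact set K ⊂ ℝ^N and every T' ∈ (0,T). -/
open MeasureTheory Real Set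

/-- The Gauss–Weierstrass heat kernel `Γ₂(x,t) = (4πt)^{-N/2} exp(-|x|²/(4t))` on `ℝ^N`. -/
noncomputable def heatKernel (N : ℕ) (x : EuclideanSpace ℝ (Fin N)) (t : ℝ) : ℝ :=
  (4 * Real.pi * t) ^ (-(N:ℝ)/2) * Real.exp (-‖x‖^2 / (4*t))

/-- If a measurable `u : ℝ^N × (0,T) → [0,∞]` is finite a.e. and dominates its own Duhamel
term, then `u^p` is locally integrable on `ℝ^N × [0,T)`. -/
theorem stmt_16 (N : ℕ) (hN : 1 ≤ N) (p : ℝ) (hp : 1 < p) (T : ℝ) (hT : 0 < T)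
    (u : EuclideanSpace ℝ (Fin N) → ℝ → ENNReal)
    (hu_meas : Measurable (Function.uncurry u))
    (hu : ∀ t ∈ Set.Ioo (0:ℝ) T, ∀ᵐ x : EuclideanSpace ℝ (Fin N),
      u x t < ⊤ ∧
      (∫⁻ s in Set.Ioo (0:ℝ) t, ∫⁻ y,
          ENNReal.ofReal (heatKernel N (x - y) (t - s)) * u y s ^ p) ≤ u x t) :
    ∀ K : Set (EuclideanSpace ℝ (Fin N)), IsCompact K → ∀ T' ∈ Set.Ioo (0:ℝ) T,
      (∫⁻ s in Set.Ioo (0:ℝ) T', ∫⁻ y in K, u y s ^ p) < ⊤ := by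
  intro K hK T' hT'
  obtain ⟨h0, h1⟩ := hT'
  obtain ⟨t, ht1, ht2⟩ := exists_between h1
  have ht0 : 0 < t := h0.trans ht1
  obtain ⟨x, hx1, hx2⟩ := (hu t ⟨ht0, ht2⟩).exists
  obtain ⟨R, hR⟩ := hK.isBounded.subset_closedBall x
  set c : ℝ := (4 * Real.pi * t) ^ (-(N:ℝ)/2) * Real.exp (-R^2 / (4*(t - T'))) with hc
  have hcpos : 0 < c := by positivity
  have hker : ∀ s ∈ Set.Ioo (0:ℝ) T', ∀ y ∈ K, c ≤ heatKernel N (x - y) (t - s) := by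
    intro s hs y hy
    have hts : 0 < t - s := by linarith [hs.2]
    have htT : 0 < t - T' := by linarith
    have hy' : ‖x - y‖ ≤ R := by
      have := hR hy
      rwa [Metric.mem_closedBall, dist_comm, dist_eq_norm] at this
    have hpi := Real.pi_pos
    unfold heatKernel
    rw [hc]
    apply mul_le_mul _ _ (Real.exp_pos _).le (by positivity)
    · apply Real.rpow_le_rpow_of_nonpos (by positivity)
      · have : t - s ≤ t := by linarith [hs.1]
        gcongr
      · have : (0:ℝ) ≤ N := Nat.cast_nonneg N
        linarith
    · apply Real.exp_le_exp.mpr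
      rw [neg_div, neg_div]
      apply neg_le_neg
      have : t - T' ≤ t - s := by linarith [hs.2]
      gcongr
  have key : ENNReal.ofReal c * (∫⁻ s in Set.Ioo (0:ℝ) T', ∫⁻ y in K, u y s ^ p) ≤ u x t := by
    refine le_trans ?_ hx2
    rw [← lintegral_const_mul' _ _ ENNReal.ofReal_ne_top]
    refine le_trans ?_ (lintegral_mono_set (Set.Ioo_subset_Ioo_right ht1.le))
    apply setLIntegral_mono' measurableSet_Ioo
    intro s hs
    rw [← lintegral_const_mul' _ _ ENNReal.ofReal_ne_top]
    refine le_trans ?_ (setLIntegral_le_lintegral K _)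
    apply setLIntegral_mono' hK.measurableSet
    intro y hy
    gcongr
    exact hker s hs y hy
  by_contra h
  rw [not_lt, top_le_iff] at h
  rw [h, ENNReal.mul_top (by simpa using hcpos)] at key
  exact absurd hx1 (not_lt.mpr key)
end
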